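/- arXiv:2503.18508 — 2 statements merged into one kernel-verified Lean document; each statement's English description precedes it below -/
import Mathlib

section
/- There is a universal constant C > 0 such that for every integer d ≥ 3, every finite subset M of ℓ_∞^d, and every Δ > 0, the metric space M admits a (C·(log d)^4·√d, Δ)-Lipschitz decomposition. -/
noncomputable section

open scoped NNReal ENNReal

/-- A `(β, Δ)`-Lipschitz decomposition of a (pseudo)metric space `α`: a probability
distribution over partitions of `α` (encoded as equivalence relations / setoids) such that
every cluster of every partition in the support has diameter at most `Δ` (i.e. any two
equivalent points are at distance at most `Δ`), and any two points `x, y` are separated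
(put in different clusters) with probability at most `β * dist x y / Δ`. -/
def LipschitzDecomp (α : Type*) [PseudoMetricSpace α] (β Δ : ℝ) : Prop :=
  ∃ D : PMF (Setoid α),
    (∀ R ∈ D.support, ∀ x y : α, R.r x y → dist x y ≤ Δ) ∧
    (∀ x y : α, D.toOuterMeasure {R | ¬ R.r x y} ≤ ENNReal.ofReal (β * dist x y / Δ))

open MeasureTheory

theorem toOuterMeasure_le_one {β : Type*} (p : PMF β) (s : Set β) : p.toOuterMeasure s ≤ 1 := by
  rw [PMF.toOuterMeasure_apply, ← p.tsum_coe]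
  exact ENNReal.tsum_le_tsum fun x => Set.indicator_le_self _ _ x

/-- Random carving: repeatedly pick a random subset `S` with probability proportional to `w S`,
among those meeting the part of `A` not carved out yet, and carve it out as a cluster. -/
theorem exists_random_labeling {α : Type*} [Finite α] (w : Set α → ℝ≥0∞) (r : α → α → ℝ≥0∞)
    (hpos : ∀ x, ∃ S, x ∈ S ∧ w S ≠ 0) (hfin : ∀ S : Set α, S.Nonempty → w S ≠ ⊤)
    (hr : ∀ x y, ∑' S, {S : Set α | ¬ (x ∈ S ↔ y ∈ S)}.indicator w S ≤
      r x y * ∑' S, {S : Set α | x ∈ S}.indicator w S) (A : Set α) :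
    ∃ D : PMF (α → ℕ),
      (∀ l ∈ D.support, ∀ x ∈ A, ∀ y ∈ A, l x = l y → ∃ S, x ∈ S ∧ y ∈ S ∧ w S ≠ 0) ∧
      ∀ x ∈ A, ∀ y ∈ A, D.toOuterMeasure {l | l x ≠ l y} ≤ r x y := by
  classical
  induction A using WellFoundedLT.induction with
  | ind A ih =>
  rcases A.eq_empty_or_nonempty with rfl | ⟨a, ha⟩
  · exact ⟨PMF.pure 0, by simp, by simp⟩
  have hD : ∀ S : Set α, ∃ D : PMF (α → ℕ), (S ∩ A).Nonempty →
      (∀ l ∈ D.support, ∀ x ∈ A \ S, ∀ y ∈ A \ S, l x = l y →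
        ∃ S, x ∈ S ∧ y ∈ S ∧ w S ≠ 0) ∧
      ∀ x ∈ A \ S, ∀ y ∈ A \ S, D.toOuterMeasure {l | l x ≠ l y} ≤ r x y := by
    intro S
    by_cases hS : (S ∩ A).Nonempty
    · have hlt : A \ S < A := by
        refine Set.sdiff_subset.lt_of_not_ge fun h => ?_
        obtain ⟨z, hzS, hzA⟩ := hS
        exact (h hzA).2 hzS
      obtain ⟨D, hD⟩ := ih _ hlt
      exact ⟨D, fun _ => hD⟩
    · exact ⟨PMF.pure 0, fun h => absurd h hS⟩
  choose D hD using hD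
  set v : Set α → ℝ≥0∞ := {S : Set α | (S ∩ A).Nonempty}.indicator w with hv
  have hvw : ∀ S, (S ∩ A).Nonempty → v S = w S := fun S hS =>
    Set.indicator_of_mem (s := {S : Set α | (S ∩ A).Nonempty}) hS w
  have v0 : ∑' S, v S ≠ 0 := by
    obtain ⟨S, haS, hS⟩ := hpos a
    rw [Ne, ENNReal.tsum_eq_zero]
    intro h
    apply hS
    exact (hvw S ⟨a, haS, ha⟩).symm.trans (h S)
  have vtop : ∑' S, v S ≠ ⊤ := by
    have := Fintype.ofFinite (Set α)
    rw [tsum_fintype]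
    refine ENNReal.sum_ne_top.2 fun S _ => ?_
    by_cases hS : (S ∩ A).Nonempty
    · rw [hvw S hS]
      exact hfin S hS.left
    · rw [hv, Set.indicator_of_notMem (by exact hS)]
      simp
  have hsupp : ∀ S, PMF.normalize v v0 vtop S ≠ 0 → (S ∩ A).Nonempty ∧ w S ≠ 0 := by
    intro S hS
    have : S ∈ Function.support v := by
      rw [← PMF.support_normalize v0 vtop]
      exact hS
    rw [hv, Function.mem_support, Set.indicator_apply_ne_zero] at this
    exact this
  let relabel : Set α → (α → ℕ) → α → ℕ := fun S l x => if x ∈ S then 0 else l x + 1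
  refine ⟨(PMF.normalize v v0 vtop).bind fun S => (D S).map (relabel S), ?_, ?_⟩
  · intro l hl x hx y hy hxy
    obtain ⟨S, hS, hl⟩ := (PMF.mem_support_bind_iff _ _ _).1 hl
    obtain ⟨l, hl', rfl⟩ := (PMF.mem_support_map_iff _ _ _).1 hl
    obtain ⟨hSA, hwS⟩ := hsupp S hS
    by_cases h1 : x ∈ S <;> by_cases h2 : y ∈ S <;> simp [relabel, h1, h2] at hxy
    · exact ⟨S, h1, h2, hwS⟩
    · exact (hD S hSA).1 l hl' x ⟨hx, h1⟩ y ⟨hy, h2⟩ hxy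
  · intro x hx y hy
    have key : ∀ S, PMF.normalize v v0 vtop S *
        ((D S).map (relabel S)).toOuterMeasure {l | l x ≠ l y} ≤
        ({S : Set α | ¬ (x ∈ S ↔ y ∈ S)}.indicator w S +
          r x y * {S : Set α | x ∉ S}.indicator v S) * (∑' S, v S)⁻¹ := by
      intro S
      by_cases hS : PMF.normalize v v0 vtop S = 0
      · simp [hS]
      obtain ⟨hSA, hwS⟩ := hsupp S hS
      rw [PMF.normalize_apply, mul_right_comm]
      gcongr
      have hvS := hvw S hSA
      rw [PMF.toOuterMeasure_map_apply]
      by_cases h1 : x ∈ S <;> by_cases h2 : y ∈ S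
      · simp [relabel, h1, h2]
      · simp only [Set.indicator, Set.mem_ofPred_eq, h1, h2, hvS]
        simpa using mul_le_of_le_one_right' (toOuterMeasure_le_one _ _)
      · simp only [Set.indicator, Set.mem_ofPred_eq, h1, h2, hvS]
        simpa using le_add_right (mul_le_of_le_one_right' (toOuterMeasure_le_one _ _))
      · have := (hD S hSA).2 x ⟨hx, h1⟩ y ⟨hy, h2⟩
        simp only [Set.indicator, Set.mem_ofPred_eq, h1, h2, hvS, relabel]
        simp only [Set.preimage_ofPred_eq, h1, h2]
        simpa [mul_comm] using mul_le_mul_right this (w S)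
    rw [PMF.toOuterMeasure_bind_apply]
    refine (ENNReal.tsum_le_tsum key).trans ?_
    rw [ENNReal.tsum_mul_right, ENNReal.tsum_add, ENNReal.tsum_mul_left, ← div_eq_mul_inv]
    refine ENNReal.div_le_of_le_mul ?_
    refine (add_le_add_left (hr x y) _).trans ?_
    rw [← mul_add, ← ENNReal.tsum_add]
    gcongr with S
    by_cases h1 : x ∈ S
    · have := hvw S ⟨x, h1, hx⟩
      simp [h1, this]
    · simp [h1]

/-- Carving with the random cluster `{x | ω ∈ E x}`, where `ω` is drawn from the measure `ν`. -/
theorem LipschitzDecomp.of_measurable_sets {α Ω : Type*} [PseudoMetricSpace α] [Finite α]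
    [MeasurableSpace Ω] (ν : Measure Ω) (E : α → Set Ω) (hE : ∀ x, MeasurableSet (E x))
    (hpos : ∀ x, ν (E x) ≠ 0) (hfin : ∀ x, ν (E x) ≠ ⊤) {β Δ : ℝ}
    (hdiam : ∀ x y, (E x ∩ E y).Nonempty → dist x y ≤ Δ)
    (hsep : ∀ x y, ν (E x \ E y ∪ E y \ E x) ≤ ENNReal.ofReal (β * dist x y / Δ) * ν (E x)) :
    LipschitzDecomp α β Δ := by
  classical
  let φ : Ω → Set α := fun ω => {x | ω ∈ E x}
  have hφ : Measurable φ := measurable_set_iff.2 fun x => (hE x).mem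
  let w : Set α → ℝ≥0∞ := fun S => ν.map φ {S}
  have hw : ∀ T : Set (Set α), ∑' S, T.indicator w S = ν (φ ⁻¹' T) := fun T => by
    rw [← Measure.map_apply hφ T.toFinite.measurableSet]
    exact Measure.tsum_indicator_apply_singleton _ _ T.toFinite.measurableSet
  have hw1 : ∀ S, w S = ν (φ ⁻¹' {S}) := fun S =>
    Measure.map_apply hφ (Set.toFinite _).measurableSet
  have hpos' : ∀ x, ∃ S, x ∈ S ∧ w S ≠ 0 := by
    intro x
    by_contra! h
    apply hpos x
    have : ν (φ ⁻¹' {S | x ∈ S}) = 0 := by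
      rw [← hw, ENNReal.tsum_eq_zero]
      intro S
      by_cases hS : x ∈ S
      · simp [hS, h S hS]
      · simp [hS]
    exact this
  have hfin' : ∀ S : Set α, S.Nonempty → w S ≠ ⊤ := by
    rintro S ⟨x, hx⟩
    rw [hw1]
    refine measure_ne_top_of_subset ?_ (hfin x)
    rintro ω rfl
    exact hx
  have hsep' : ∀ x y, ∑' S, {S : Set α | ¬ (x ∈ S ↔ y ∈ S)}.indicator w S ≤
      ENNReal.ofReal (β * dist x y / Δ) * ∑' S, {S : Set α | x ∈ S}.indicator w S := by
    intro x y
    rw [hw, hw]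
    refine le_trans (measure_mono ?_) (hsep x y)
    intro ω hω
    by_cases h1 : ω ∈ E x <;> by_cases h2 : ω ∈ E y <;> simp_all [φ]
  obtain ⟨D, hD, hD'⟩ := exists_random_labeling w
    (fun x y => ENNReal.ofReal (β * dist x y / Δ)) hpos' hfin' hsep' Set.univ
  refine ⟨D.map Setoid.ker, ?_, ?_⟩
  · intro R hR x y hxy
    obtain ⟨l, hl, rfl⟩ := (PMF.mem_support_map_iff _ _ _).1 hR
    obtain ⟨S, hx, hy, hS⟩ := hD l hl x trivial y trivial hxy
    rw [hw1] at hS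
    obtain ⟨ω, hω⟩ := nonempty_of_measure_ne_zero hS
    have hω : φ ω = S := hω
    subst hω
    exact hdiam x y ⟨ω, hx, hy⟩
  · intro x y
    rw [PMF.toOuterMeasure_map_apply]
    exact hD' x trivial y trivial

/-- Carving with random superlevel sets of a family of densities of equal mass. -/
theorem LipschitzDecomp.of_densities {α Ω : Type*} [PseudoMetricSpace α] [Finite α]
    [MeasurableSpace Ω] (μ : Measure Ω) [SigmaFinite μ] (F : α → Ω → ℝ)
    (hF : ∀ x, Measurable (F x)) (hF0 : ∀ x t, 0 ≤ F x t) (hFi : ∀ x, Integrable (F x) μ)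
    {I : ℝ} (hI : 0 < I) (hFI : ∀ x, ∫ t, F x t ∂μ = I) {β Δ : ℝ}
    (hr0 : ∀ x y : α, 0 ≤ β * dist x y / Δ)
    (hdiam : ∀ x y t, F x t ≠ 0 → F y t ≠ 0 → dist x y ≤ Δ)
    (hsep : ∀ x y, (1 - β * dist x y / Δ / 2) * I ≤ ∫ t, min (F x t) (F y t) ∂μ) :
    LipschitzDecomp α β Δ := by
  let E : α → Set (Ω × ℝ) := fun x => regionBetween 0 (F x) Set.univ
  have hE : ∀ x, MeasurableSet (E x) := fun x =>
    measurableSet_regionBetween measurable_zero (hF x) .univ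
  have hEvol : ∀ G : Ω → ℝ, (∀ t, 0 ≤ G t) → Integrable G μ →
      μ.prod volume (regionBetween 0 G Set.univ) = ENNReal.ofReal (∫ t, G t ∂μ) := by
    intro G hG hGi
    rw [volume_regionBetween_eq_integral (integrable_zero _ _ _).integrableOn hGi.integrableOn
      .univ fun t _ => hG t]
    simp
  have hE1 : ∀ x, μ.prod volume (E x) = ENNReal.ofReal I := fun x => by
    rw [← hFI x]
    exact hEvol _ (hF0 x) (hFi x)
  have hdiff : ∀ x y, μ.prod volume (E x \ E y) ≤
      ENNReal.ofReal (β * dist x y / Δ / 2 * I) := by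
    intro x y
    have h1 : E x ∩ E y = regionBetween 0 (fun t => min (F x t) (F y t)) Set.univ := by
      ext ⟨t, u⟩
      simp only [E, regionBetween, Set.mem_inter_iff, Set.mem_ofPred_eq, Set.mem_Ioo, lt_min_iff]
      tauto
    have h2 := hEvol (fun t => min (F x t) (F y t)) (fun t => le_min (hF0 x t) (hF0 y t))
      ((hFi x).inf (hFi y))
    rw [← h1] at h2
    rw [← Set.sdiff_inter_self_eq_sdiff, Set.inter_comm, measure_sdiff Set.inter_subset_left
      ((hE x).inter (hE y)).nullMeasurableSet (by simp [h2]), h2, hE1,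
      ← ENNReal.ofReal_sub _ (integral_nonneg fun t => le_min (hF0 x t) (hF0 y t))]
    exact ENNReal.ofReal_le_ofReal (by linarith [hsep x y])
  refine .of_measurable_sets (μ.prod volume) E hE (fun x => by simp [hE1, hI])
    (fun x => by simp [hE1]) ?_ fun x y => ?_
  · rintro x y ⟨⟨t, u⟩, ⟨-, hx⟩, -, hy⟩
    exact hdiam x y t (hx.1.trans hx.2).ne' (hy.1.trans hy.2).ne'
  · refine (measure_union_le _ _).trans ((add_le_add (hdiff x y) (hdiff y x)).trans ?_)
    have := hr0 x y
    rw [hE1, dist_comm y x, ← ENNReal.ofReal_add (by positivity) (by positivity),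
      ← ENNReal.ofReal_mul (by positivity)]
    exact ENNReal.ofReal_le_ofReal (by linarith)

/-- The tent function `max 0 (1 - |t|)`. -/
def tent (t : ℝ) : ℝ := max 0 (1 - |t|)

theorem tent_nonneg (t : ℝ) : 0 ≤ tent t := le_max_left _ _

theorem continuous_tent : Continuous tent := by unfold tent; fun_prop

theorem tent_eq_zero {t : ℝ} (h : 1 ≤ |t|) : tent t = 0 := max_eq_left (by linarith)

theorem abs_tent_sub_tent_le (a b : ℝ) : |tent a - tent b| ≤ |a - b| := by
  refine (abs_max_sub_max_le_max _ _ _ _).trans ?_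
  rw [sub_self, abs_zero, sub_sub_sub_cancel_left, max_eq_right (abs_nonneg _), abs_sub_comm a]
  exact abs_abs_sub_abs_le b a

theorem integrable_tent_mul_tent (a b : ℝ) :
    Integrable fun t => tent (t - a) * tent (t - b) := by
  refine Continuous.integrable_of_hasCompactSupport ?_ ?_
  · exact (continuous_tent.comp (by fun_prop)).mul (continuous_tent.comp (by fun_prop))
  · refine HasCompactSupport.intro (isCompact_Icc (a := a - 1) (b := a + 1)) fun t ht => ?_
    rw [tent_eq_zero, zero_mul]
    by_contra! h
    rw [abs_lt] at h
    exact ht ⟨by linarith, by linarith⟩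

theorem integral_tent_sub_sq (a : ℝ) :
    ∫ t, tent (t - a) * tent (t - a) = ∫ t, tent t * tent t :=
  integral_sub_right_eq_self (fun t => tent t * tent t) a

theorem quarter_le_integral_tent_sq : 1 / 4 ≤ ∫ t, tent t * tent t := by
  have h := integrable_tent_mul_tent 0 0
  simp only [sub_zero] at h
  calc (1 / 4 : ℝ) = ∫ t in Set.Icc (-1 / 2 : ℝ) (1 / 2), (1 / 4 : ℝ) := by
        simp; norm_num
    _ ≤ ∫ t in Set.Icc (-1 / 2 : ℝ) (1 / 2), tent t * tent t := by
        refine setIntegral_mono_on (by simp) h.integrableOn measurableSet_Icc fun t ht => ?_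
        have h1 : |t| ≤ 1 / 2 := abs_le.2 ⟨by linarith [ht.1], ht.2⟩
        have h2 : 1 / 2 ≤ tent t := le_max_of_le_right (by linarith)
        nlinarith
    _ ≤ ∫ t, tent t * tent t :=
        setIntegral_le_integral h (ae_of_all _ fun t => mul_self_nonneg _)

theorem integral_tent_mul_tent_eq (a b : ℝ) :
    ∫ t, tent (t - a) * tent (t - b) =
      (∫ t, tent t * tent t) - (∫ t, (tent (t - a) - tent (t - b)) ^ 2) / 2 := by
  have h : ∫ t, (tent (t - a) - tent (t - b)) ^ 2 =
      ∫ t, (tent (t - a) * tent (t - a) + tent (t - b) * tent (t - b) -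
        2 * (tent (t - a) * tent (t - b))) := by
    congr with t; ring
  rw [h, integral_sub ((integrable_tent_mul_tent a a).fun_add (integrable_tent_mul_tent b b))
    ((integrable_tent_mul_tent a b).const_mul 2), integral_add (integrable_tent_mul_tent a a)
    (integrable_tent_mul_tent b b), integral_const_mul, integral_tent_sub_sq,
    integral_tent_sub_sq]
  ring

theorem integral_tent_sub_tent_sq_le (a b : ℝ) :
    ∫ t, (tent (t - a) - tent (t - b)) ^ 2 ≤ 4 * (a - b) ^ 2 := by
  set s : Set ℝ := Set.Icc (a - 1) (a + 1) ∪ Set.Icc (b - 1) (b + 1) with hs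
  have hmem : ∀ c t : ℝ, t ∉ Set.Icc (c - 1) (c + 1) → tent (t - c) = 0 := by
    intro c t ht
    refine tent_eq_zero ?_
    by_contra! h
    rw [abs_lt] at h
    exact ht ⟨by linarith, by linarith⟩
  have hvol : volume s ≤ ENNReal.ofReal 4 := by
    refine (measure_union_le _ _).trans ?_
    rw [Real.volume_Icc, Real.volume_Icc, ← ENNReal.ofReal_add (by linarith) (by linarith)]
    exact ENNReal.ofReal_le_ofReal (by linarith)
  have hreal : volume.real s ≤ 4 := ENNReal.toReal_le_of_le_ofReal (by norm_num) hvol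
  rw [← setIntegral_eq_integral_of_forall_compl_eq_zero (s := s)]
  · refine (Real.le_norm_self _).trans ((norm_setIntegral_le_of_norm_le_const
      (hvol.trans_lt ENNReal.ofReal_lt_top) (C := (a - b) ^ 2) fun t _ => ?_).trans ?_)
    · rw [norm_pow, Real.norm_eq_abs, sq_abs]
      refine sq_le_sq.2 ((abs_tent_sub_tent_le _ _).trans_eq ?_)
      rw [sub_sub_sub_cancel_left, abs_sub_comm]
    · nlinarith [sq_nonneg (a - b)]
  · intro t ht
    rw [hs, Set.mem_union, not_or] at ht
    rw [hmem a t ht.1, hmem b t ht.2]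
    simp

theorem one_sub_mul_le_integral_tent_mul_tent (a b : ℝ) :
    (1 - 8 * (a - b) ^ 2) * ∫ t, tent t * tent t ≤ ∫ t, tent (t - a) * tent (t - b) := by
  rw [integral_tent_mul_tent_eq]
  nlinarith [integral_tent_sub_tent_sq_le a b, quarter_le_integral_tent_sq, sq_nonneg (a - b)]

theorem integral_tent_mul_tent_le (a b : ℝ) :
    ∫ t, tent (t - a) * tent (t - b) ≤ ∫ t, tent t * tent t := by
  rw [integral_tent_mul_tent_eq]
  have : 0 ≤ ∫ t, (tent (t - a) - tent (t - b)) ^ 2 := integral_nonneg fun t => sq_nonneg _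
  linarith

theorem one_sub_sum_mul_prod_le_prod {ι : Type*} (s : Finset ι) (f g ε : ι → ℝ)
    (hε : ∀ i, 0 ≤ ε i) (hf : ∀ i, 0 ≤ f i) (hfg : ∀ i, f i ≤ g i)
    (h : ∀ i, (1 - ε i) * g i ≤ f i) :
    (1 - ∑ i ∈ s, ε i) * ∏ i ∈ s, g i ≤ ∏ i ∈ s, f i := by
  classical
  induction s using Finset.induction_on with
  | empty => simp
  | insert a s ha ih =>
    rw [Finset.sum_insert ha, Finset.prod_insert ha, Finset.prod_insert ha]
    have hP : 0 ≤ ∏ i ∈ s, g i := Finset.prod_nonneg fun i _ => (hf i).trans (hfg i)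
    have hS : 0 ≤ ∑ i ∈ s, ε i := Finset.sum_nonneg fun i _ => hε i
    calc (1 - (ε a + ∑ i ∈ s, ε i)) * (g a * ∏ i ∈ s, g i)
        = (1 - ε a) * g a * ∏ i ∈ s, g i - (∑ i ∈ s, ε i) * (g a * ∏ i ∈ s, g i) := by ring
      _ ≤ f a * ∏ i ∈ s, g i - (∑ i ∈ s, ε i) * (f a * ∏ i ∈ s, g i) := by
          gcongr
          · exact h a
          · exact hfg a
      _ = f a * ((1 - ∑ i ∈ s, ε i) * ∏ i ∈ s, g i) := by ring
      _ ≤ f a * ∏ i ∈ s, f i := by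
          gcongr
          exact hf a

section Bump

variable {ι : Type*} [Fintype ι]

/-- A product of tent functions centred at `p`. -/
def bump (p t : ι → ℝ) : ℝ := ∏ i, tent (t i - p i)

theorem bump_nonneg (p t : ι → ℝ) : 0 ≤ bump p t := Finset.prod_nonneg fun _ _ => tent_nonneg _

theorem continuous_bump (p : ι → ℝ) : Continuous (bump p) :=
  continuous_finsetProd _ fun i _ => continuous_tent.comp (by fun_prop)

theorem abs_sub_lt_one_of_bump_ne_zero {p t : ι → ℝ} (h : bump p t ≠ 0) (i : ι) :
    |t i - p i| < 1 := by
  by_contra! hi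
  exact h (Finset.prod_eq_zero (Finset.mem_univ i) (tent_eq_zero hi))

theorem integrable_bump_mul_bump (p q : ι → ℝ) : Integrable fun t => bump p t * bump q t := by
  simp only [bump, ← Finset.prod_mul_distrib]
  exact Integrable.fintype_prod (f := fun i s => tent (s - p i) * tent (s - q i))
    fun i => integrable_tent_mul_tent _ _

theorem integral_bump_mul_bump (p q : ι → ℝ) :
    ∫ t, bump p t * bump q t = ∏ i, ∫ s, tent (s - p i) * tent (s - q i) := by
  simp only [bump, ← Finset.prod_mul_distrib]
  exact integral_fintype_prod_volume_eq_prod fun i s => tent (s - p i) * tent (s - q i)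

theorem integral_bump_sq (p : ι → ℝ) :
    ∫ t, bump p t * bump p t = (∫ s, tent s * tent s) ^ Fintype.card ι := by
  rw [integral_bump_mul_bump]
  simp [integral_tent_sub_sq]

theorem one_sub_mul_le_integral_bump_mul_bump {p q : ι → ℝ} {s : ℝ}
    (hs : ∀ i, |p i - q i| ≤ s) :
    (1 - 8 * Fintype.card ι * s ^ 2) * (∫ s, tent s * tent s) ^ Fintype.card ι ≤
      ∫ t, bump p t * bump q t := by
  have hN := quarter_le_integral_tent_sq
  have hle : ∑ i, 8 * (p i - q i) ^ 2 ≤ 8 * Fintype.card ι * s ^ 2 := by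
    refine (Finset.sum_le_card_nsmul _ _ (8 * s ^ 2) fun i _ => ?_).trans_eq ?_
    · rw [← sq_abs]
      gcongr
      exact hs i
    · simp only [Finset.card_univ, nsmul_eq_mul]; ring
  have := one_sub_sum_mul_prod_le_prod Finset.univ
    (fun i => ∫ t, tent (t - p i) * tent (t - q i)) (fun _ => ∫ t, tent t * tent t)
    (fun i => 8 * (p i - q i) ^ 2) (fun i => by positivity)
    (fun i => integral_nonneg fun t => mul_nonneg (tent_nonneg _) (tent_nonneg _))
    (fun i => integral_tent_mul_tent_le _ _)
    (fun i => one_sub_mul_le_integral_tent_mul_tent _ _)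
  rw [Finset.prod_const, Finset.card_univ, ← integral_bump_mul_bump] at this
  refine le_trans ?_ this
  gcongr

/-- A lower bound for the mass of the minimum of two squared bumps, from the
Cauchy–Schwarz inequality in the form `2 |g² - h²| ≤ e⁻¹ (g - h)² + e (g + h)²`. -/
theorem one_sub_mul_le_integral_min_bump_sq {p q : ι → ℝ} {s : ℝ} (hι : 0 < Fintype.card ι)
    (hs0 : 0 < s) (hs : ∀ i, |p i - q i| ≤ s) :
    (1 - 4 * √(Fintype.card ι) * s) * (∫ s, tent s * tent s) ^ Fintype.card ι ≤
      ∫ t, min (bump p t * bump p t) (bump q t * bump q t) := by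
  have hN := quarter_le_integral_tent_sq
  set I := (∫ s, tent s * tent s) ^ Fintype.card ι with hI
  have hI0 : 0 ≤ I := by positivity
  set k := √(Fintype.card ι) with hk
  have hk0 : 0 < k := Real.sqrt_pos.2 (by exact_mod_cast hι)
  have hk2 : (Fintype.card ι : ℝ) = k ^ 2 := (Real.sq_sqrt (by positivity)).symm
  set e := 2 * k * s with he
  have he0 : 0 < e := by positivity
  have hpt : ∀ t, (1 / 2 - e⁻¹ / 4 - e / 2) * (bump p t * bump p t + bump q t * bump q t) +
      e⁻¹ / 2 * (bump p t * bump q t) ≤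
      min (bump p t * bump p t) (bump q t * bump q t) := by
    intro t
    have key : ∀ g h : ℝ, 0 ≤ g → 0 ≤ h →
        (1 / 2 - e⁻¹ / 4 - e / 2) * (g * g + h * h) + e⁻¹ / 2 * (g * h) ≤ g * g := by
      intro g h hg hh
      have h1 : h * h - g * g ≤ e⁻¹ / 2 * (g - h) ^ 2 + e / 2 * (g + h) ^ 2 := by
        have : 0 ≤ e⁻¹ / 2 * ((g - h) + e * (g + h)) ^ 2 := by positivity
        have h2 : e⁻¹ / 2 * ((g - h) + e * (g + h)) ^ 2 = e⁻¹ / 2 * (g - h) ^ 2 +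
          e / 2 * (g + h) ^ 2 + (g * g - h * h) := by field_simp; ring
        linarith
      nlinarith [mul_nonneg he0.le (sq_nonneg (g - h))]
    refine le_min (key _ _ (bump_nonneg _ _) (bump_nonneg _ _)) ?_
    rw [add_comm (bump p t * bump p t), mul_comm (bump p t) (bump q t)]
    exact key _ _ (bump_nonneg _ _) (bump_nonneg _ _)
  have hp := integrable_bump_mul_bump p p
  have hq := integrable_bump_mul_bump q q
  have hpq := integrable_bump_mul_bump p q
  have hmono := integral_mono (((hp.fun_add hq).const_mul (1 / 2 - e⁻¹ / 4 - e / 2)).fun_add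
    (hpq.const_mul (e⁻¹ / 2))) (hp.inf hq) hpt
  refine le_trans ?_ hmono
  rw [integral_add ((hp.fun_add hq).const_mul _) (hpq.const_mul _), integral_const_mul,
    integral_const_mul, integral_add hp hq, integral_bump_sq, integral_bump_sq, ← hI]
  have hmul := mul_le_mul_of_nonneg_left (one_sub_mul_le_integral_bump_mul_bump hs)
    (show 0 ≤ e⁻¹ / 2 by positivity)
  rw [← hI, hk2] at hmul
  refine le_trans (le_of_eq ?_) (add_le_add_right hmul _)
  rw [he]
  field_simp
  ring

end Bump

theorem LipschitzDecomp.mono {α : Type*} [PseudoMetricSpace α] {β β' Δ : ℝ} (hΔ : 0 ≤ Δ)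
    (hβ : β ≤ β') (h : LipschitzDecomp α β Δ) : LipschitzDecomp α β' Δ := by
  obtain ⟨D, h1, h2⟩ := h
  refine ⟨D, h1, fun x y => (h2 x y).trans (ENNReal.ofReal_le_ofReal ?_)⟩
  gcongr

theorem lipschitzDecomp_linfty {ι : Type*} [Fintype ι] [Nonempty ι]
    {M : Set (PiLp ⊤ fun _ : ι => ℝ)} (hM : M.Finite) {Δ : ℝ} (hΔ : 0 < Δ) :
    LipschitzDecomp M (16 * √(Fintype.card ι)) Δ := by
  have := hM.to_subtype
  have hN := quarter_le_integral_tent_sq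
  let p : M → ι → ℝ := fun x i => 2 / Δ * x.1 i
  have hp : ∀ x y i, |p x i - p y i| = 2 / Δ * |x.1 i - y.1 i| := fun x y i => by
    rw [← mul_sub, abs_mul, abs_of_pos (by positivity)]
  refine .of_densities (I := (∫ s, tent s * tent s) ^ Fintype.card ι) volume
    (fun x t => bump (p x) t * bump (p x) t)
    (fun x => ((continuous_bump _).mul (continuous_bump _)).measurable)
    (fun x t => mul_self_nonneg _) (fun x => integrable_bump_mul_bump _ _) (by positivity)
    (fun x => integral_bump_sq _) (fun x y => by positivity) (fun x y t hx hy => ?_)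
    fun x y => ?_
  · rw [Subtype.dist_eq, PiLp.dist_eq_iSup]
    refine ciSup_le fun i => ?_
    have hx := abs_lt.1 (abs_sub_lt_one_of_bump_ne_zero (left_ne_zero_of_mul hx) i)
    have hy := abs_lt.1 (abs_sub_lt_one_of_bump_ne_zero (left_ne_zero_of_mul hy) i)
    have h : 2 / Δ * |x.1 i - y.1 i| ≤ 2 := by
      rw [← hp, abs_le]
      exact ⟨by linarith, by linarith⟩
    rw [div_mul_eq_mul_div, div_le_iff₀ hΔ] at h
    rw [Real.dist_eq]
    linarith
  · rcases eq_or_ne x y with rfl | hxy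
    · simp [integral_bump_sq]
    · have hd : 0 < dist x y := dist_pos.2 hxy
      refine le_trans (le_of_eq ?_) (one_sub_mul_le_integral_min_bump_sq (s := 2 / Δ * dist x y)
        Fintype.card_pos (by positivity) fun i => ?_)
      · congr 1
        ring
      · rw [hp]
        gcongr
        rw [Subtype.dist_eq, dist_eq_norm]
        exact PiLp.norm_apply_le (x.1 - y.1) i

/-- There is a universal constant `C > 0` such that for every integer `d ≥ 3`, every finite
subset `M` of `ℓ_∞^d`, and every `Δ > 0`, the metric space `M` admits a
`(C * (log d)^4 * √d, Δ)`-Lipschitz decomposition. -/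
theorem lipschitz_decomposition_linfty_d :
    ∃ C : ℝ, 0 < C ∧
      ∀ (d : ℕ), 3 ≤ d →
      ∀ (M : Set (PiLp ⊤ (fun _ : Fin d => ℝ))),
        M.Finite →
        ∀ Δ : ℝ, 0 < Δ →
          LipschitzDecomp M (C * Real.log d ^ 4 * Real.sqrt d) Δ := by
  refine ⟨16, by norm_num, fun d hd M hM Δ hΔ => ?_⟩
  have : Nonempty (Fin d) := ⟨⟨0, by lia⟩⟩
  refine (lipschitzDecomp_linfty hM hΔ).mono hΔ.le ?_
  rw [Fintype.card_fin]
  have hlog : 1 ≤ Real.log d := by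
    rw [Real.le_log_iff_exp_le (by positivity)]
    have : (3 : ℝ) ≤ d := by exact_mod_cast hd
    linarith [Real.exp_one_lt_three]
  have := one_le_pow₀ hlog (n := 4)
  gcongr
  linarith
end
end

section
/- For every real p with 3 < p < 3·√e and every ε with 0 < ε ≤ 1, there exists a constant C = C(p,ε) > 0 such that for every integer n ≥ 2 and every subset X of ℓ_p with at most n points, X embeds into the Hilbert space ℓ_2 with distortion at most C·(log n)^{1/2 + ln(p/3) + ε}. -/
noncomputable section

open scoped NNReal ENNReal

/-- A metric space `M` embeds into `N` with distortion at most `D`: there are `s > 0` and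
`f : M → N` with `(s / D) * dist x y ≤ dist (f x) (f y) ≤ s * dist x y` for all `x, y`. -/
def EmbedsWithDistortion (M N : Type*) [PseudoMetricSpace M] [PseudoMetricSpace N]
    (D : ℝ) : Prop :=
  ∃ s : ℝ, 0 < s ∧ ∃ f : M → N, ∀ x y : M,
    s / D * dist x y ≤ dist (f x) (f y) ∧ dist (f x) (f y) ≤ s * dist x y

/-- The real sequence space `ℓ_q` for a real exponent `q`. -/
abbrev RealLp (q : ℝ) : Type := lp (fun _ : ℕ => ℝ) (ENNReal.ofReal q)

/-- The real Hilbert space `ℓ_2`. -/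
abbrev HilbertSeq : Type := lp (fun _ : ℕ => ℝ) 2

theorem exists_hilbertSeq_realization {E ι : Type*} [NormedAddCommGroup E]
    [InnerProductSpace ℝ E] [Finite ι] (v : ι → E) :
    ∃ w : ι → HilbertSeq, (∀ i, ‖w i‖ = ‖v i‖) ∧ ∀ i j, ‖w i - w j‖ = ‖v i - v j‖ := by
  let F := Submodule.span ℝ (Set.range v)
  have : FiniteDimensional ℝ F := FiniteDimensional.span_of_finite ℝ (Set.finite_range v)
  let b := stdOrthonormalBasis ℝ F
  let e : Fin (Module.finrank ℝ F) → HilbertSeq := fun j => lp.single 2 (j : ℕ) (1 : ℝ)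
  have he : Orthonormal ℝ e := by
    rw [orthonormal_iff_ite]
    intro i j
    simp only [e, lp.inner_single_left]
    by_cases h : i = j
    · subst h; simp
    · have : (i : ℕ) ≠ j := fun h' => h (Fin.ext h')
      simp [lp.single_apply, h, this]
  let T : F →ₗᵢ[ℝ] HilbertSeq :=
    (b.toBasis.constr ℝ e).isometryOfOrthonormal (v := b.toBasis) (by simp [b.orthonormal])
      (by
        have : (b.toBasis.constr ℝ e) ∘ b.toBasis = e := by
          ext1 j; simp
        rw [this]; exact he)
  have hv : ∀ i, v i ∈ F := fun i => Submodule.subset_span ⟨i, rfl⟩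
  refine ⟨fun i => T ⟨v i, hv i⟩, fun i => by rw [T.norm_map]; rfl, fun i j => ?_⟩
  rw [← map_sub, T.norm_map]; rfl

/-- Positive semidefiniteness of the Gaussian kernel on a finite family of vectors. -/
theorem posSemidef_gaussian {E ι : Type*} [NormedAddCommGroup E]
    [InnerProductSpace ℝ E] [Fintype ι] (v : ι → E) :
    (Matrix.of fun i j => Real.exp (-‖v i - v j‖ ^ 2)).PosSemidef := by
  classical
  let G : Matrix ι ι ℝ := Matrix.gram ℝ v
  have hG : G.PosSemidef := Matrix.posSemidef_gram ℝ v
  have hpow : ∀ k : ℕ, (Matrix.of fun i j => (2 * inner ℝ (v i) (v j)) ^ k : Matrix ι ι ℝ).PosSemidef := by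
    intro k
    induction k with
    | zero =>
      have := Matrix.posSemidef_vecMulVec_self_star (fun _ : ι => (1 : ℝ))
      convert this using 1
      ext i j; simp [Matrix.vecMulVec]
    | succ k ih =>
      have h2 := hG.smul (show (0 : ℝ) ≤ 2 by norm_num)
      have h3 : (Matrix.of fun i j => (2 * inner ℝ (v i) (v j)) ^ (k + 1) : Matrix ι ι ℝ) =
          (Matrix.of fun i j => (2 * inner ℝ (v i) (v j)) ^ k).hadamard ((2 : ℝ) • G) := by
        ext i j; simp [G, Matrix.gram_apply, pow_succ]
      rw [h3]
      exact Matrix.PosSemidef.hadamard (𝕜 := ℝ) ih h2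
  have hsum : ∀ n : ℕ, ∀ x : ι → ℝ, 0 ≤ ∑ i, ∑ j, x i * x j *
      ∑ k ∈ Finset.range n, (2 * inner ℝ (v i) (v j)) ^ k / k.factorial := by
    intro n x
    have : ∑ i, ∑ j, x i * x j * ∑ k ∈ Finset.range n, (2 * inner ℝ (v i) (v j)) ^ k / k.factorial
        = ∑ k ∈ Finset.range n, (1 / k.factorial : ℝ) *
          ∑ i, ∑ j, x i * x j * (2 * inner ℝ (v i) (v j)) ^ k := by
      simp only [Finset.mul_sum]
      rw [Finset.sum_comm]
      conv_rhs => rw [Finset.sum_comm]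
      rw [Finset.sum_comm]
      refine Finset.sum_congr rfl fun i _ => ?_
      rw [Finset.sum_comm]
      refine Finset.sum_congr rfl fun k _ => Finset.sum_congr rfl fun j _ => ?_
      ring
    rw [this]
    refine Finset.sum_nonneg fun k _ => mul_nonneg (by positivity) ?_
    have := (hpow k).dotProduct_mulVec_nonneg x
    convert this using 1
    simp [dotProduct, Matrix.mulVec, Finset.mul_sum]
    refine Finset.sum_congr rfl fun i _ => Finset.sum_congr rfl fun j _ => by ring
  have hexp : ∀ x : ι → ℝ, 0 ≤ ∑ i, ∑ j, x i * x j * Real.exp (2 * inner ℝ (v i) (v j)) := by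
    intro x
    refine ge_of_tendsto' (f := fun n => ∑ i, ∑ j, x i * x j *
      ∑ k ∈ Finset.range n, (2 * inner ℝ (v i) (v j)) ^ k / k.factorial) (x := Filter.atTop) ?_
      (fun n => hsum n x)
    refine tendsto_finsetSum _ fun i _ => tendsto_finsetSum _ fun j _ => ?_
    refine Filter.Tendsto.const_mul _ ?_
    rw [Real.exp_eq_exp_ℝ]
    exact (NormedSpace.expSeries_div_hasSum_exp _).tendsto_sum_nat
  refine Matrix.PosSemidef.of_dotProduct_mulVec_nonneg ?_ fun x => ?_
  · ext i j; simp [norm_sub_rev]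
  · have := hexp (fun i => x i * Real.exp (-‖v i‖ ^ 2))
    refine this.trans_eq ?_
    simp only [dotProduct, Matrix.mulVec, Matrix.of_apply, Finset.mul_sum]
    refine Finset.sum_congr rfl fun i _ => Finset.sum_congr rfl fun j _ => ?_
    rw [norm_sub_sq_real, show -(‖v i‖ ^ 2 - 2 * inner ℝ (v i) (v j) + ‖v j‖ ^ 2) =
      -‖v i‖ ^ 2 + -‖v j‖ ^ 2 + 2 * inner ℝ (v i) (v j) by ring, Real.exp_add, Real.exp_add]
    simp only [Pi.star_apply, star_trivial]; ring

theorem exists_truncation {E ι : Type*} [NormedAddCommGroup E]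
    [InnerProductSpace ℝ E] [Fintype ι] (v : ι → E) {τ : ℝ} (hτ : 0 < τ) :
    ∃ f : ι → HilbertSeq, (∀ i, ‖f i‖ ≤ τ) ∧ (∀ i j, ‖f i - f j‖ ≤ ‖v i - v j‖) ∧
      ∀ i j, τ ≤ ‖v i - v j‖ → τ / 2 ≤ ‖f i - f j‖ := by
  classical
  set r : ℝ := 1 / (√2 * τ) with hr
  have hr0 : 0 < r := by positivity
  have hr2 : 2 * τ ^ 2 * r ^ 2 = 1 := by
    rw [hr, div_pow, mul_pow, Real.sq_sqrt (by norm_num)]; field_simp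
  obtain ⟨m, A, hA⟩ := Matrix.posSemidef_iff_eq_sum_vecMulVec.mp
    (posSemidef_gaussian fun i => r • v i)
  let g : ι → EuclideanSpace ℝ (Fin m) := fun i => WithLp.toLp 2 fun k => τ * A k i
  have hinner : ∀ i j, inner ℝ (g i) (g j) = τ ^ 2 * Real.exp (-(r * ‖v i - v j‖) ^ 2) := by
    intro i j
    have h := congrFun (congrFun hA i) j
    simp only [Matrix.of_apply, Matrix.sum_apply, Matrix.vecMulVec_apply, ← smul_sub, norm_smul,
      Real.norm_of_nonneg hr0.le] at h
    rw [h, Finset.mul_sum]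
    simp only [g, PiLp.inner_apply]
    refine Finset.sum_congr rfl fun k _ => ?_
    simp; ring
  have hnorm : ∀ i, ‖g i‖ = τ := by
    intro i
    have h := hinner i i
    rw [real_inner_self_eq_norm_sq] at h
    simp at h
    exact (pow_left_inj₀ (norm_nonneg _) hτ.le two_ne_zero).1 h
  have hdist : ∀ i j, ‖g i - g j‖ ^ 2 = 2 * τ ^ 2 * (1 - Real.exp (-(r * ‖v i - v j‖) ^ 2)) := by
    intro i j
    rw [norm_sub_sq_real, hinner, hnorm, hnorm]; ring
  obtain ⟨w, hw, hw'⟩ := exists_hilbertSeq_realization g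
  refine ⟨w, fun i => by rw [hw, hnorm], fun i j => ?_, fun i j hij => ?_⟩
  · rw [hw']
    refine (pow_le_pow_iff_left₀ (by positivity) (by positivity) two_ne_zero).1 ?_
    rw [hdist]
    have := Real.add_one_le_exp (-(r * ‖v i - v j‖) ^ 2)
    calc 2 * τ ^ 2 * (1 - Real.exp (-(r * ‖v i - v j‖) ^ 2))
        ≤ 2 * τ ^ 2 * (r * ‖v i - v j‖) ^ 2 := by gcongr; linarith
      _ = ‖v i - v j‖ ^ 2 := by rw [mul_pow, ← mul_assoc, hr2, one_mul]
  · rw [hw']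
    refine (pow_le_pow_iff_left₀ (by positivity) (by positivity) two_ne_zero).1 ?_
    rw [hdist]
    have h1 : (1 / 2 : ℝ) ≤ (r * ‖v i - v j‖) ^ 2 := by
      have : (r * τ) ^ 2 ≤ (r * ‖v i - v j‖) ^ 2 := by gcongr
      nlinarith
    have h2 : Real.exp (-(r * ‖v i - v j‖) ^ 2) ≤ 2 / 3 := by
      have h3 : Real.exp (-(r * ‖v i - v j‖) ^ 2) ≤ Real.exp (-(1 / 2)) := by gcongr
      have h4 : Real.exp (-(1 / 2)) ≤ 2 / 3 := by
        rw [Real.exp_neg, inv_le_comm₀ (Real.exp_pos _) (by norm_num)]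
        have := Real.add_one_le_exp (1 / 2 : ℝ); linarith
      linarith
    nlinarith [sq_nonneg τ]

/-- Signed power `sign a * |a| ^ σ`. -/
def signedPow (σ a : ℝ) : ℝ := SignType.sign a * |a| ^ σ

theorem abs_signedPow {σ : ℝ} (hσ : σ ≠ 0) (a : ℝ) : |signedPow σ a| = |a| ^ σ := by
  rcases eq_or_ne a 0 with rfl | ha
  · simp [signedPow, Real.zero_rpow hσ]
  · rw [signedPow, abs_mul, abs_of_nonneg (Real.rpow_nonneg (abs_nonneg a) σ)]
    rcases lt_or_gt_of_ne ha with h | h <;> simp [h]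

theorem signedPow_neg (σ a : ℝ) : signedPow σ (-a) = -signedPow σ a := by
  simp [signedPow, Left.sign_neg]

theorem signedPow_of_nonneg {σ a : ℝ} (hσ : σ ≠ 0) (ha : 0 ≤ a) : signedPow σ a = a ^ σ := by
  rcases ha.eq_or_lt with rfl | h
  · simp [signedPow, Real.zero_rpow hσ]
  · simp [signedPow, h, abs_of_pos h]

theorem rpow_sub_rpow_le {σ a b : ℝ} (hσ : 1 ≤ σ) (hb : 0 ≤ b) (hab : b ≤ a) :
    a ^ σ - b ^ σ ≤ σ * (a - b) * a ^ (σ - 1) := by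
  rcases (hb.trans hab).eq_or_lt with rfl | ha
  · have : b = 0 := le_antisymm hab hb
    subst this; simp
  · have h := one_add_mul_self_le_rpow_one_add (s := b / a - 1) (by
      have : 0 ≤ b / a := by positivity
      linarith) hσ
    have h1 : (1 + (b / a - 1)) ^ σ = b ^ σ / a ^ σ := by
      rw [add_sub_cancel, Real.div_rpow hb ha.le]
    have h2 : a ^ σ = a * a ^ (σ - 1) := by
      rw [Real.rpow_sub_one ha.ne']; field_simp
    have hpos : 0 < a ^ σ := Real.rpow_pos_of_pos ha σ
    rw [h1, le_div_iff₀ hpos] at h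
    have h3 : (1 + σ * (b / a - 1)) * a ^ σ = a ^ σ - σ * (a - b) * a ^ (σ - 1) := by
      rw [h2]; field_simp; ring
    linarith

theorem signedPow_estimates {σ : ℝ} (hσ : 1 ≤ σ) (a b : ℝ) :
    |signedPow σ a - signedPow σ b| ≤ σ * |a - b| * (|a| + |b|) ^ (σ - 1) ∧
      |a - b| ^ σ ≤ 2 ^ (σ - 1) * |signedPow σ a - signedPow σ b| := by
  have hσ0 : σ ≠ 0 := by linarith
  have h2 : (1 : ℝ) ≤ 2 ^ (σ - 1) := Real.one_le_rpow (by norm_num) (by linarith)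
  have main : ∀ a b : ℝ, 0 ≤ a → b ≤ a → -a ≤ b →
      |signedPow σ a - signedPow σ b| ≤ σ * |a - b| * (|a| + |b|) ^ (σ - 1) ∧
      |a - b| ^ σ ≤ 2 ^ (σ - 1) * |signedPow σ a - signedPow σ b| := by
    intro a b ha hab _
    rw [abs_of_nonneg (sub_nonneg.2 hab), abs_of_nonneg ha]
    rcases le_total 0 b with hb | hb
    · rw [signedPow_of_nonneg hσ0 ha, signedPow_of_nonneg hσ0 hb, abs_of_nonneg hb]
      have hle : b ^ σ ≤ a ^ σ := Real.rpow_le_rpow hb hab (by linarith)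
      rw [abs_of_nonneg (sub_nonneg.2 hle)]
      constructor
      · refine (rpow_sub_rpow_le hσ hb hab).trans ?_
        have : 0 ≤ σ * (a - b) := mul_nonneg (by linarith) (sub_nonneg.2 hab)
        gcongr
        linarith
      · have := Real.add_rpow_le_rpow_add (sub_nonneg.2 hab) hb hσ
        rw [sub_add_cancel] at this
        have h3 : 0 ≤ a ^ σ - b ^ σ := sub_nonneg.2 hle
        nlinarith
    · obtain ⟨c, rfl⟩ : ∃ c, b = -c := ⟨-b, by ring⟩
      have hc : 0 ≤ c := by linarith
      rw [signedPow_neg, signedPow_of_nonneg hσ0 ha, signedPow_of_nonneg hσ0 hc, abs_neg,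
        abs_of_nonneg hc, sub_neg_eq_add, sub_neg_eq_add,
        abs_of_nonneg (add_nonneg (Real.rpow_nonneg ha σ) (Real.rpow_nonneg hc σ))]
      constructor
      · refine (Real.add_rpow_le_rpow_add ha hc hσ).trans ?_
        rcases (add_nonneg ha hc).eq_or_lt with h | h
        · rw [← h]; simp [Real.zero_rpow hσ0]
        · have : (a + c) ^ σ = (a + c) * (a + c) ^ (σ - 1) := by
            rw [Real.rpow_sub_one h.ne']; field_simp
          rw [this, mul_assoc]
          exact le_mul_of_one_le_left (by positivity) hσ
      · lift a to ℝ≥0 using ha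
        lift c to ℝ≥0 using hc
        exact_mod_cast NNReal.rpow_add_le_mul_rpow_add_rpow a c hσ
  rcases le_total |b| |a| with h | h
  · rcases le_total 0 a with ha | ha
    · rw [abs_of_nonneg ha, abs_le] at h
      exact main a b ha h.2 h.1
    · rw [abs_of_nonpos ha, abs_le] at h
      have := main (-a) (-b) (by linarith) (by linarith) (by linarith)
      rw [signedPow_neg, signedPow_neg, abs_neg, abs_neg, ← neg_sub', ← neg_sub', abs_neg,
        abs_neg] at this
      exact this
  · rw [abs_sub_comm (signedPow σ a), abs_sub_comm a, add_comm |a|]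
    rcases le_total 0 b with ha | ha
    · rw [abs_of_nonneg ha, abs_le] at h
      exact main b a ha h.2 h.1
    · rw [abs_of_nonpos ha, abs_le] at h
      have := main (-b) (-a) (by linarith) (by linarith) (by linarith)
      rw [signedPow_neg, signedPow_neg, abs_neg, abs_neg, ← neg_sub', ← neg_sub', abs_neg,
        abs_neg] at this
      exact this

theorem RealLp.norm_rpow {q : ℝ} (hq : 0 < q) (x : RealLp q) : ‖x‖ ^ q = ∑' i, |x i| ^ q := by
  have h : (ENNReal.ofReal q).toReal = q := ENNReal.toReal_ofReal hq.le
  have := lp.norm_rpow_eq_tsum (p := ENNReal.ofReal q) (by rw [h]; exact hq) x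
  rw [h] at this
  exact this

theorem RealLp.summable {q : ℝ} (hq : 0 < q) (x : RealLp q) : Summable fun i => |x i| ^ q := by
  have h : (ENNReal.ofReal q).toReal = q := ENNReal.toReal_ofReal hq.le
  have := (lp.memℓp x).summable (by rw [h]; exact hq)
  rw [h] at this
  exact this

/-- The Mazur map from `ℓ_p` to `ℓ_q`. -/
def mazurMap {p q : ℝ} (hq : 0 < q) (hpq : q ≤ p) (x : RealLp p) : RealLp q :=
  ⟨fun i => signedPow (p / q) (x i), by
    have h : (ENNReal.ofReal q).toReal = q := ENNReal.toReal_ofReal hq.le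
    refine memℓp_gen ?_
    rw [h]
    refine (RealLp.summable (hq.trans_le hpq) x).congr fun i => ?_
    have hs : p / q ≠ 0 := (div_pos (hq.trans_le hpq) hq).ne'
    rw [Real.norm_eq_abs, abs_signedPow hs, ← Real.rpow_mul (abs_nonneg _), div_mul_cancel₀ _ hq.ne']⟩

theorem mazurMap_lower {p q : ℝ} (hq : 0 < q) (hpq : q ≤ p) (x y : RealLp p) :
    ‖x - y‖ ^ (p / q) ≤ 2 ^ (p / q - 1) * ‖mazurMap hq hpq x - mazurMap hq hpq y‖ := by
  have hp := hq.trans_le hpq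
  have hs : 1 ≤ p / q := (one_le_div hq).2 hpq
  refine (Real.rpow_le_rpow_iff (Real.rpow_nonneg (lp.norm_nonneg' (x - y)) _)
    (mul_nonneg (by positivity) (lp.norm_nonneg' _)) hq).1 ?_
  rw [← Real.rpow_mul (lp.norm_nonneg' _), div_mul_cancel₀ _ hq.ne', RealLp.norm_rpow hp,
    Real.mul_rpow (by positivity) (lp.norm_nonneg' _), RealLp.norm_rpow hq, ← tsum_mul_left]
  refine Summable.tsum_le_tsum (fun i => ?_) (RealLp.summable hp _)
    ((RealLp.summable hq _).mul_left _)
  rw [← Real.mul_rpow (by positivity) (abs_nonneg _)]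
  have := (signedPow_estimates hs (x i) (y i)).2
  have h2 := Real.rpow_le_rpow (by positivity) this hq.le
  rw [← Real.rpow_mul (abs_nonneg _), div_mul_cancel₀ _ hq.ne'] at h2
  exact h2

theorem mazurMap_upper {p q Δ : ℝ} (hq : 0 < q) (hp1 : 1 ≤ p) (hpq : q < p) (x y : RealLp p)
    (hx : ‖x‖ ≤ Δ) (hy : ‖y‖ ≤ Δ) :
    ‖mazurMap hq hpq.le x - mazurMap hq hpq.le y‖ ≤
      (p / q) * (2 * Δ) ^ (p / q - 1) * ‖x - y‖ := by
  have hp := hq.trans hpq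
  have hs : 1 < p / q := (one_lt_div hq).2 hpq
  have hΔ : 0 ≤ Δ := (lp.norm_nonneg' _).trans hx
  have hw : ∀ i, (|x i| + |y i|) ^ p ≤ 2 ^ (p - 1) * (|x i| ^ p + |y i| ^ p) := by
    intro i
    have hx := abs_nonneg (x i)
    have hy := abs_nonneg (y i)
    lift |x i| to ℝ≥0 using hx with a
    lift |y i| to ℝ≥0 using hy with b
    exact_mod_cast NNReal.rpow_add_le_mul_rpow_add_rpow a b hp1
  have hwsum0 : Summable fun i => 2 ^ (p - 1) * (|x i| ^ p + |y i| ^ p) :=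
    ((RealLp.summable hp x).add (RealLp.summable hp y)).mul_left _
  have hwsum : Summable fun i => (|x i| + |y i|) ^ p :=
    hwsum0.of_nonneg_of_le (fun i => by positivity) hw
  have hwle : ∑' i, (|x i| + |y i|) ^ p ≤ (2 * Δ) ^ p := by
    calc ∑' i, (|x i| + |y i|) ^ p ≤ ∑' i, 2 ^ (p - 1) * (|x i| ^ p + |y i| ^ p) :=
          hwsum.tsum_le_tsum hw hwsum0
      _ = 2 ^ (p - 1) * (‖x‖ ^ p + ‖y‖ ^ p) := by
          rw [tsum_mul_left, (RealLp.summable hp x).tsum_add (RealLp.summable hp y),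
            RealLp.norm_rpow hp, RealLp.norm_rpow hp]
      _ ≤ 2 ^ (p - 1) * (Δ ^ p + Δ ^ p) := by
          have h1 := Real.rpow_le_rpow (lp.norm_nonneg' _) hx hp.le
          have h2 := Real.rpow_le_rpow (lp.norm_nonneg' _) hy hp.le
          gcongr
      _ = (2 * Δ) ^ p := by
          rw [Real.mul_rpow (by norm_num) hΔ, Real.rpow_sub_one (by norm_num)]; ring
  set σ := p / q with hσ
  have hσq : σ * q = p := div_mul_cancel₀ _ hq.ne'
  have hconj : σ.HolderConjugate (σ / (σ - 1)) := Real.HolderConjugate.conjExponent hs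
  have hσ1 : 0 < σ - 1 := by linarith
  have hf : ∀ i, (|(x - y) i| ^ q) ^ σ = |(x - y) i| ^ p := fun i => by
    rw [← Real.rpow_mul (abs_nonneg _), mul_comm q, hσq]
  have hg : ∀ i, ((|x i| + |y i|) ^ ((σ - 1) * q)) ^ (σ / (σ - 1)) = (|x i| + |y i|) ^ p := fun i => by
    rw [← Real.rpow_mul (by positivity), show (σ - 1) * q * (σ / (σ - 1)) = p by
      rw [← hσq]; field_simp]
  obtain ⟨hsum, hle⟩ := Real.summable_and_inner_le_Lp_mul_Lq_tsum_of_nonneg hconj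
    (f := fun i => |(x - y) i| ^ q) (g := fun i => (|x i| + |y i|) ^ ((σ - 1) * q))
    (fun i => by positivity) (fun i => by positivity)
    ((RealLp.summable hp (x - y)).congr fun i => (hf i).symm)
    (hwsum.congr fun i => (hg i).symm)
  simp only [hf, hg] at hle
  rw [← RealLp.norm_rpow hp] at hle
  have hσ0 : 0 < σ := by linarith
  refine (Real.rpow_le_rpow_iff (lp.norm_nonneg' _) (mul_nonneg (by positivity) (lp.norm_nonneg' _)) hq).1 ?_
  rw [RealLp.norm_rpow hq]
  calc ∑' i, |(mazurMap hq hpq.le x - mazurMap hq hpq.le y) i| ^ q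
      ≤ ∑' i, σ ^ q * (|(x - y) i| ^ q * (|x i| + |y i|) ^ ((σ - 1) * q)) := by
        refine Summable.tsum_le_tsum (fun i => ?_) (RealLp.summable hq _) (hsum.mul_left _)
        have h1 := Real.rpow_le_rpow (abs_nonneg _) (signedPow_estimates hs.le (x i) (y i)).1 hq.le
        rw [Real.mul_rpow (by positivity) (by positivity), Real.mul_rpow (by positivity) (by positivity),
          ← Real.rpow_mul (by positivity), mul_assoc] at h1
        exact h1
    _ = σ ^ q * ∑' i, (|(x - y) i| ^ q * (|x i| + |y i|) ^ ((σ - 1) * q)) := tsum_mul_left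
    _ ≤ σ ^ q * ((‖x - y‖ ^ p) ^ (1 / σ) * ((2 * Δ) ^ p) ^ (1 / (σ / (σ - 1)))) := by
        refine mul_le_mul_of_nonneg_left (hle.trans ?_) (by positivity)
        refine mul_le_mul_of_nonneg_left ?_ (Real.rpow_nonneg (Real.rpow_nonneg (lp.norm_nonneg' _) _) _)
        exact Real.rpow_le_rpow (tsum_nonneg fun i => by positivity) hwle
          (by positivity)
    _ = (σ * (2 * Δ) ^ (σ - 1) * ‖x - y‖) ^ q := by
        rw [Real.mul_rpow (x := σ * (2 * Δ) ^ (σ - 1)) (by positivity) (lp.norm_nonneg' _),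
          Real.mul_rpow (x := σ) (by positivity) (by positivity),
          ← Real.rpow_mul (x := 2 * Δ) (by positivity), ← Real.rpow_mul (lp.norm_nonneg' _),
          ← Real.rpow_mul (x := 2 * Δ) (by positivity),
          show p * (1 / σ) = q by rw [← hσq]; field_simp,
          show p * (1 / (σ / (σ - 1))) = (σ - 1) * q by rw [← hσq]; field_simp]
        ring

/-- Radial retraction onto the ball of radius `Δ`. -/
def radialRetraction {E : Type*} [SeminormedAddCommGroup E] [NormedSpace ℝ E] (Δ : ℝ) (x : E) : E :=
  (Δ / max Δ ‖x‖) • x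

section Retraction
variable {E : Type*} [SeminormedAddCommGroup E] [NormedSpace ℝ E] {Δ : ℝ}

theorem norm_radialRetraction_le (hΔ : 0 < Δ) (x : E) : ‖radialRetraction Δ x‖ ≤ Δ := by
  have hm : 0 < max Δ ‖x‖ := lt_max_of_lt_left hΔ
  rw [radialRetraction, norm_smul, Real.norm_of_nonneg (by positivity), div_mul_eq_mul_div,
    div_le_iff₀ hm]
  gcongr
  exact le_max_right _ _

theorem radialRetraction_of_norm_le (hΔ : 0 < Δ) {x : E} (hx : ‖x‖ ≤ Δ) :
    radialRetraction Δ x = x := by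
  rw [radialRetraction, max_eq_left hx, div_self hΔ.ne', one_smul]

theorem norm_radialRetraction_of_le (hΔ : 0 < Δ) {x : E} (hx : Δ ≤ ‖x‖) :
    ‖radialRetraction Δ x‖ = Δ := by
  rw [radialRetraction, norm_smul, max_eq_right hx, Real.norm_of_nonneg (by positivity),
    div_mul_cancel₀]
  linarith

theorem norm_radialRetraction_sub_le (hΔ : 0 < Δ) (x y : E) :
    ‖radialRetraction Δ x - radialRetraction Δ y‖ ≤ 2 * ‖x - y‖ := by
  have hx : 0 < max Δ ‖x‖ := lt_max_of_lt_left hΔ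
  have hy : 0 < max Δ ‖y‖ := lt_max_of_lt_left hΔ
  have h1 : radialRetraction Δ x - radialRetraction Δ y =
      (Δ / max Δ ‖x‖) • (x - y) + (Δ / max Δ ‖x‖ - Δ / max Δ ‖y‖) • y := by
    simp only [radialRetraction]; module
  have h2 : Δ / max Δ ‖x‖ ≤ 1 := (div_le_one hx).2 (le_max_left _ _)
  have h3 : |Δ / max Δ ‖x‖ - Δ / max Δ ‖y‖| * ‖y‖ ≤ ‖x - y‖ := by
    have h4 : Δ / max Δ ‖x‖ - Δ / max Δ ‖y‖ =
        Δ / max Δ ‖x‖ * ((max Δ ‖y‖ - max Δ ‖x‖) / max Δ ‖y‖) := by field_simp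
    have h5 : |max Δ ‖y‖ - max Δ ‖x‖| ≤ ‖x - y‖ := by
      refine (abs_max_sub_max_le_max Δ ‖y‖ Δ ‖x‖).trans ?_
      rw [sub_self, abs_zero, max_eq_right (abs_nonneg _), norm_sub_rev]
      exact abs_norm_sub_norm_le _ _
    rw [h4, abs_mul, abs_of_nonneg (div_nonneg hΔ.le hx.le), abs_div, abs_of_pos hy]
    calc Δ / max Δ ‖x‖ * (|max Δ ‖y‖ - max Δ ‖x‖| / max Δ ‖y‖) * ‖y‖
        ≤ 1 * (|max Δ ‖y‖ - max Δ ‖x‖| / max Δ ‖y‖) * max Δ ‖y‖ := by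
          gcongr; exact le_max_right _ _
      _ = |max Δ ‖y‖ - max Δ ‖x‖| := by field_simp
      _ ≤ ‖x - y‖ := h5
  rw [h1]
  refine (norm_add_le _ _).trans ?_
  rw [norm_smul, norm_smul, Real.norm_of_nonneg (by positivity), Real.norm_eq_abs]
  have : Δ / max Δ ‖x‖ * ‖x - y‖ ≤ 1 * ‖x - y‖ := by gcongr
  linarith

/-- A point in the half-ball keeps its distance to other points. -/
theorem le_norm_radialRetraction_sub (hΔ : 0 < Δ) {t : ℝ} (ht : t ≤ Δ / 2) {x y : E}
    (hx : ‖x‖ ≤ Δ / 2) (hxy : t ≤ ‖x - y‖) :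
    t ≤ ‖radialRetraction Δ x - radialRetraction Δ y‖ := by
  rw [radialRetraction_of_norm_le hΔ (hx.trans (by linarith))]
  rcases le_total ‖y‖ Δ with hy | hy
  · rwa [radialRetraction_of_norm_le hΔ hy]
  · have := norm_sub_norm_le (radialRetraction Δ y) x
    rw [norm_radialRetraction_of_le hΔ hy, norm_sub_rev] at this
    linarith
end Retraction

theorem fact_one_le_ofReal {q : ℝ} (hq : 1 ≤ q) : Fact (1 ≤ ENNReal.ofReal q) :=
  ⟨by simpa using ENNReal.ofReal_le_ofReal hq⟩

/-- A `1`-Lipschitz map `ℓ_p → ℓ_q` that controls distances from points in a ball. -/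
theorem exists_local_map {p q : ℝ} (hq : 1 ≤ q) (hpq : q ≤ p) :
    ∃ c : ℝ, 0 < c ∧ c ≤ 1 ∧ ∀ Δ : ℝ, 0 < Δ → ∃ N : RealLp p → RealLp q,
      (∀ x y, ‖N x - N y‖ ≤ ‖x - y‖) ∧
      ∀ x y t, ‖x‖ ≤ Δ / 2 → 0 < t → t ≤ Δ / 2 → t ≤ ‖x - y‖ →
        c * t * (Δ / t) ^ (1 - p / q) ≤ ‖N x - N y‖ := by
  have hp := hq.trans hpq
  have hq0 : 0 < q := by linarith
  have := fact_one_le_ofReal hp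
  have := fact_one_le_ofReal hq
  rcases hpq.eq_or_lt with rfl | hlt
  · refine ⟨1 / 2, by norm_num, by norm_num, fun Δ hΔ => ⟨fun x => (1 / 2 : ℝ) • radialRetraction Δ x,
      fun x y => ?_, fun x y t hx ht htΔ hxy => ?_⟩⟩
    · rw [← smul_sub, norm_smul]
      have := norm_radialRetraction_sub_le hΔ x y
      norm_num; linarith
    · rw [← smul_sub, norm_smul]
      have := le_norm_radialRetraction_sub hΔ htΔ hx hxy
      rw [div_self hq0.ne', sub_self, Real.rpow_zero]
      norm_num; linarith
  · set σ := p / q with hσ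
    have hs : 1 < σ := (one_lt_div hq0).2 hlt
    have hσ0 : 0 < σ := by linarith
    have h21 : (1 : ℝ) ≤ 2 ^ (σ - 1) := Real.one_le_rpow (by norm_num) (by linarith)
    refine ⟨1 / (2 * σ * 2 ^ (σ - 1) * 2 ^ (σ - 1)), by positivity, ?_, fun Δ hΔ => ?_⟩
    · rw [div_le_one (by positivity)]
      have h22 : 1 ≤ (2:ℝ) ^ (σ - 1) * 2 ^ (σ - 1) := one_le_mul_of_one_le_of_one_le h21 h21
      rw [mul_assoc]
      exact one_le_mul_of_one_le_of_one_le (by linarith) h22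
    · set b := 2 * (σ * (2 * Δ) ^ (σ - 1)) with hb
      have hb0 : 0 < b := by positivity
      refine ⟨fun x => b⁻¹ • mazurMap hq0 hpq (radialRetraction Δ x), fun x y => ?_,
        fun x y t hx ht htΔ hxy => ?_⟩
      · rw [← smul_sub, norm_smul, Real.norm_of_nonneg (by positivity), inv_mul_le_iff₀ hb0]
        refine (mazurMap_upper hq0 hp hlt _ _ (norm_radialRetraction_le hΔ x)
          (norm_radialRetraction_le hΔ y)).trans ?_
        rw [hb, mul_comm 2 (σ * _), mul_assoc _ 2]
        exact mul_le_mul_of_nonneg_left (norm_radialRetraction_sub_le hΔ x y) (by positivity)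
      · rw [← smul_sub, norm_smul, Real.norm_of_nonneg (by positivity), le_inv_mul_iff₀ hb0]
        have h1 := le_norm_radialRetraction_sub hΔ htΔ hx hxy
        have h2 := mazurMap_lower hq0 hpq (radialRetraction Δ x) (radialRetraction Δ y)
        have h3 : t ^ σ ≤ ‖radialRetraction Δ x - radialRetraction Δ y‖ ^ σ := by gcongr
        have h4 : b * (1 / (2 * σ * 2 ^ (σ - 1) * 2 ^ (σ - 1)) * t * (Δ / t) ^ (1 - σ)) =
            t ^ σ / 2 ^ (σ - 1) := by
          have e1 : (Δ / t) ^ (1 - σ) = t ^ (σ - 1) / Δ ^ (σ - 1) := by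
            rw [← neg_sub σ 1, Real.rpow_neg (by positivity), Real.div_rpow hΔ.le ht.le, inv_div]
          have e2 : t ^ σ = t * t ^ (σ - 1) := by
            rw [Real.rpow_sub_one ht.ne']; field_simp
          rw [hb, e1, e2, Real.mul_rpow (by norm_num) hΔ.le]
          field_simp
        rw [h4, div_le_iff₀' (by positivity)]
        exact h3.trans h2

/-- Finitely many `ℓ_2`-valued maps can be concatenated into one. -/
theorem exists_concat {ι κ : Type*} [Finite ι] [Fintype κ] (u : κ → ι → HilbertSeq) :
    ∃ w : ι → HilbertSeq, (∀ i, ‖w i‖ ^ 2 = ∑ k, ‖u k i‖ ^ 2) ∧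
      ∀ i j, ‖w i - w j‖ ^ 2 = ∑ k, ‖u k i - u k j‖ ^ 2 := by
  obtain ⟨w, hw, hw'⟩ := exists_hilbertSeq_realization
    (fun i => (WithLp.toLp 2 (fun k => u k i) : PiLp 2 fun _ : κ => HilbertSeq))
  refine ⟨w, fun i => ?_, fun i j => ?_⟩
  · rw [hw, PiLp.norm_sq_eq_of_L2]
  · rw [hw', PiLp.norm_sq_eq_of_L2]; rfl

/-- Gluing bounded maps with scalar weights: the weights themselves are recorded in extra
coordinates so that cancellation cannot destroy the lower bound. -/
theorem exists_weighted_concat {ι κ : Type*} [Finite ι] [Fintype κ] (F : κ → ι → HilbertSeq)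
    (a : κ → ι → ℝ) {T : ℝ} (hF : ∀ k i, ‖F k i‖ ≤ T) :
    ∃ u : ι → HilbertSeq, (∀ i, ‖u i‖ ^ 2 ≤ 2 * T ^ 2 * ∑ k, a k i ^ 2) ∧
      (∀ i j, ‖u i - u j‖ ^ 2 ≤ ∑ k, (2 * (a k i ^ 2 * ‖F k i - F k j‖ ^ 2) +
        3 * ((a k i - a k j) ^ 2 * T ^ 2))) ∧
      ∀ i j, ∑ k, a k i ^ 2 * ‖F k i - F k j‖ ^ 2 ≤ 2 * ‖u i - u j‖ ^ 2 := by
  let e : HilbertSeq := lp.single 2 0 (1 : ℝ)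
  have he : ‖e‖ = 1 := by simp [e, lp.norm_single]
  obtain ⟨u, hu, hu'⟩ := exists_concat (κ := κ ⊕ κ)
    (Sum.elim (fun k i => a k i • F k i) (fun k i => (a k i * T) • e))
  have hT : ∀ (k : κ) (i : ι), 0 ≤ T := fun k i => (norm_nonneg _).trans (hF k i)
  have hsq : ∀ k i, ‖F k i‖ ^ 2 ≤ T ^ 2 := fun k i => by
    have := hF k i
    gcongr
  have split : ∀ k i j, a k i • F k i - a k j • F k j =
      a k i • (F k i - F k j) + (a k i - a k j) • F k j := fun k i j => by module
  have key : ∀ k i j, ‖a k i • F k i - a k j • F k j‖ ^ 2 ≤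
      2 * (a k i ^ 2 * ‖F k i - F k j‖ ^ 2) + 2 * ((a k i - a k j) ^ 2 * T ^ 2) := by
    intro k i j
    rw [split]
    have h1 := norm_add_le (a k i • (F k i - F k j)) ((a k i - a k j) • F k j)
    have h2 : ‖a k i • (F k i - F k j)‖ ^ 2 = a k i ^ 2 * ‖F k i - F k j‖ ^ 2 := by
      rw [norm_smul, mul_pow, Real.norm_eq_abs, sq_abs]
    have h3 : ‖(a k i - a k j) • F k j‖ ^ 2 ≤ (a k i - a k j) ^ 2 * T ^ 2 := by
      rw [norm_smul, mul_pow, Real.norm_eq_abs, sq_abs]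
      exact mul_le_mul_of_nonneg_left (hsq k j) (sq_nonneg _)
    have h4 := pow_le_pow_left₀ (norm_nonneg _) h1 2
    nlinarith [sq_nonneg (‖a k i • (F k i - F k j)‖ - ‖(a k i - a k j) • F k j‖)]
  have key' : ∀ k i j, a k i ^ 2 * ‖F k i - F k j‖ ^ 2 ≤
      2 * ‖a k i • F k i - a k j • F k j‖ ^ 2 + 2 * ((a k i - a k j) ^ 2 * T ^ 2) := by
    intro k i j
    have h1 := norm_sub_le (a k i • F k i - a k j • F k j) ((a k i - a k j) • F k j)
    rw [split, add_sub_cancel_right, ← split] at h1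
    have h2 : ‖a k i • (F k i - F k j)‖ ^ 2 = a k i ^ 2 * ‖F k i - F k j‖ ^ 2 := by
      rw [norm_smul, mul_pow, Real.norm_eq_abs, sq_abs]
    have h3 : ‖(a k i - a k j) • F k j‖ ^ 2 ≤ (a k i - a k j) ^ 2 * T ^ 2 := by
      rw [norm_smul, mul_pow, Real.norm_eq_abs, sq_abs]
      exact mul_le_mul_of_nonneg_left (hsq k j) (sq_nonneg _)
    have h4 := pow_le_pow_left₀ (norm_nonneg _) h1 2
    nlinarith [sq_nonneg (‖a k i • F k i - a k j • F k j‖ - ‖(a k i - a k j) • F k j‖)]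
  have hsecond : ∀ k i j, ‖(a k i * T) • e - (a k j * T) • e‖ ^ 2 = (a k i - a k j) ^ 2 * T ^ 2 := by
    intro k i j
    rw [← sub_smul, norm_smul, he, mul_one, Real.norm_eq_abs, sq_abs]; ring
  simp only [Fintype.sum_sum_type, Sum.elim_inl, Sum.elim_inr, hsecond] at hu hu'
  refine ⟨u, fun i => ?_, fun i j => ?_, fun i j => ?_⟩
  · rw [hu, ← Finset.sum_add_distrib, Finset.mul_sum]
    refine Finset.sum_le_sum fun k _ => ?_
    rw [norm_smul, norm_smul, he, mul_pow, Real.norm_eq_abs, Real.norm_eq_abs, sq_abs, mul_one,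
      sq_abs]
    nlinarith [mul_le_mul_of_nonneg_left (hsq k i) (sq_nonneg (a k i))]
  · rw [hu', ← Finset.sum_add_distrib]
    refine Finset.sum_le_sum fun k _ => ?_
    linarith [key k i j]
  · rw [hu', ← Finset.sum_add_distrib, Finset.mul_sum]
    refine Finset.sum_le_sum fun k _ => ?_
    linarith [key' k i j]

section SoftVolume
variable {ι : Type*} [Fintype ι] [PseudoMetricSpace ι]

/-- Exponentially smoothed number of points at distance about `t` from `x`. -/
def softVol (t : ℝ) (x : ι) : ℝ := ∑ c, Real.exp (-(dist x c / t))

/-- Logarithm of the smoothed volume. -/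
def logVol (t : ℝ) (x : ι) : ℝ := Real.log (softVol t x)

/-- Square roots of a smooth partition of unity indexed by the points `c`. -/
def softWeight (t : ℝ) (c x : ι) : ℝ := Real.exp (-(dist x c / t + logVol t x) / 2)

/-- Growth of the logarithmic volume between the scales `t` and `128 t`. -/
def volGrowth (t : ℝ) (x : ι) : ℝ := logVol (128 * t) x - logVol t x

theorem one_le_softVol (t : ℝ) (x : ι) : 1 ≤ softVol t x := by
  have : Real.exp (-(dist x x / t)) ≤ softVol t x :=
    Finset.single_le_sum (f := fun c => Real.exp (-(dist x c / t)))
      (fun c _ => (Real.exp_pos _).le) (Finset.mem_univ x)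
  simpa using this

theorem softVol_pos (t : ℝ) (x : ι) : 0 < softVol t x := one_pos.trans_le (one_le_softVol t x)

theorem exp_logVol (t : ℝ) (x : ι) : Real.exp (logVol t x) = softVol t x :=
  Real.exp_log (softVol_pos t x)

theorem logVol_nonneg (t : ℝ) (x : ι) : 0 ≤ logVol t x := Real.log_nonneg (one_le_softVol t x)

theorem logVol_le {t L : ℝ} (ht : 0 < t) (hL : (Fintype.card ι : ℝ) ≤ Real.exp L) (x : ι) :
    logVol t x ≤ L := by
  rw [logVol, Real.log_le_iff_le_exp (softVol_pos t x)]
  refine le_trans ?_ hL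
  calc softVol t x ≤ ∑ _c : ι, (1 : ℝ) := Finset.sum_le_sum fun c _ => by
        rw [Real.exp_le_one_iff, neg_nonpos]; positivity
    _ = Fintype.card ι := by simp

theorem softVol_mono {s t : ℝ} (hs : 0 < s) (hst : s ≤ t) (x : ι) : softVol s x ≤ softVol t x := by
  refine Finset.sum_le_sum fun c _ => ?_
  gcongr

theorem logVol_mono {s t : ℝ} (hs : 0 < s) (hst : s ≤ t) (x : ι) : logVol s x ≤ logVol t x :=
  Real.log_le_log (softVol_pos s x) (softVol_mono hs hst x)

theorem volGrowth_nonneg {t : ℝ} (ht : 0 < t) (x : ι) : 0 ≤ volGrowth t x :=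
  sub_nonneg.2 (logVol_mono ht (by linarith) x)

theorem abs_logVol_sub_le {t : ℝ} (ht : 0 < t) (x y : ι) :
    |logVol t x - logVol t y| ≤ dist x y / t := by
  have key : ∀ x y : ι, logVol t x - logVol t y ≤ dist x y / t := by
    intro x y
    rw [sub_le_iff_le_add, logVol, Real.log_le_iff_le_exp (softVol_pos t x), Real.exp_add,
      exp_logVol, softVol, softVol, Finset.mul_sum]
    refine Finset.sum_le_sum fun c _ => ?_
    rw [← Real.exp_add, Real.exp_le_exp]
    have h := dist_triangle y x c
    rw [dist_comm y x] at h
    have : dist y c / t ≤ (dist x y + dist x c) / t := by gcongr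
    rw [add_div] at this
    linarith
  rw [abs_le]
  constructor
  · have := key y x
    rw [dist_comm] at this
    linarith
  · exact key x y

theorem abs_volGrowth_sub_le {t : ℝ} (ht : 0 < t) (x y : ι) :
    |volGrowth t x - volGrowth t y| ≤ 2 * dist x y / t := by
  have h1 := abs_logVol_sub_le ht x y
  have h2 := abs_logVol_sub_le (show 0 < 128 * t by positivity) x y
  have h3 : dist x y / (128 * t) ≤ dist x y / t := by gcongr; linarith
  have h4 : 2 * dist x y / t = dist x y / t + dist x y / t := by ring
  rw [abs_le] at *
  simp only [volGrowth]
  constructor <;> linarith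

theorem softWeight_sq (t : ℝ) (c x : ι) :
    softWeight t c x ^ 2 = Real.exp (-(dist x c / t)) / softVol t x := by
  rw [softWeight, ← Real.exp_nat_mul, ← exp_logVol, ← Real.exp_sub]
  congr 1; push_cast; ring

theorem sum_softWeight_sq (t : ℝ) (x : ι) : ∑ c, softWeight t c x ^ 2 = 1 := by
  simp only [softWeight_sq]
  rw [← Finset.sum_div]
  exact div_self (softVol_pos t x).ne'

theorem sq_exp_sub_exp_le (a b : ℝ) :
    (Real.exp a - Real.exp b) ^ 2 ≤ (a - b) ^ 2 * (Real.exp a ^ 2 + Real.exp b ^ 2) := by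
  have key : ∀ a b : ℝ, b ≤ a →
      (Real.exp a - Real.exp b) ^ 2 ≤ (a - b) ^ 2 * (Real.exp a ^ 2 + Real.exp b ^ 2) := by
    intro a b hab
    have h1 : Real.exp a - Real.exp b ≤ (a - b) * Real.exp a := by
      have h2 := Real.add_one_le_exp (b - a)
      have h3 : Real.exp b = Real.exp (b - a) * Real.exp a := by rw [← Real.exp_add]; ring_nf
      rw [h3]
      nlinarith [Real.exp_pos a]
    have h0 : 0 ≤ Real.exp a - Real.exp b := sub_nonneg.2 (Real.exp_le_exp.2 hab)
    have h4 := pow_le_pow_left₀ h0 h1 2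
    nlinarith [mul_nonneg (sq_nonneg (a - b)) (sq_nonneg (Real.exp b))]
  rcases le_total b a with h | h
  · exact key a b h
  · have := key b a h
    nlinarith

theorem sum_softWeight_sub_sq_le {t : ℝ} (ht : 0 < t) (x y : ι) :
    ∑ c, (softWeight t c x - softWeight t c y) ^ 2 ≤ 2 * (dist x y / t) ^ 2 := by
  calc ∑ c, (softWeight t c x - softWeight t c y) ^ 2
      ≤ ∑ c, (dist x y / t) ^ 2 * (softWeight t c x ^ 2 + softWeight t c y ^ 2) := by
        refine Finset.sum_le_sum fun c _ => (sq_exp_sub_exp_le _ _).trans ?_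
        refine mul_le_mul_of_nonneg_right ?_ (by positivity)
        rw [← sq_abs]
        gcongr
        have h1 := abs_logVol_sub_le ht x y
        have h2 : |dist x c / t - dist y c / t| ≤ dist x y / t := by
          rw [← sub_div, abs_div, abs_of_pos ht]
          gcongr
          exact abs_dist_sub_le x y c
        rw [abs_le] at *
        constructor <;> linarith
    _ = 2 * (dist x y / t) ^ 2 := by
        rw [← Finset.mul_sum, Finset.sum_add_distrib, sum_softWeight_sq, sum_softWeight_sq]; ring

theorem sum_far_exp_le {t : ℝ} (ht : 0 < t) (x : ι) (R : ℝ) :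
    ∑ c with R ≤ dist x c, Real.exp (-(dist x c / t)) ≤
      Real.exp (-(R / (2 * t))) * softVol (2 * t) x := by
  rw [softVol, Finset.mul_sum]
  calc ∑ c with R ≤ dist x c, Real.exp (-(dist x c / t))
      ≤ ∑ c with R ≤ dist x c, Real.exp (-(R / (2 * t))) * Real.exp (-(dist x c / (2 * t))) := by
        refine Finset.sum_le_sum fun c hc => ?_
        rw [← Real.exp_add, Real.exp_le_exp]
        have h1 : R / (2 * t) ≤ dist x c / (2 * t) := by
          gcongr
          simpa using hc
        have h2 : dist x c / t = dist x c / (2 * t) + dist x c / (2 * t) := by field_simp; ring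
        linarith
    _ ≤ _ := Finset.sum_le_sum_of_subset_of_nonneg (Finset.subset_univ _)
        fun c _ _ => by positivity

theorem half_le_sum_near_softWeight {t R : ℝ} (ht : 0 < t) (x : ι)
    (hR : logVol (2 * t) x - logVol t x + 1 ≤ R / (2 * t)) :
    1 / 2 ≤ ∑ c with dist x c < R, softWeight t c x ^ 2 := by
  have h1 := sum_softWeight_sq t x
  rw [← Finset.sum_filter_add_sum_filter_not Finset.univ (fun c => dist x c < R)] at h1
  have h2 : ∑ c with ¬ dist x c < R, softWeight t c x ^ 2 ≤ 1 / 2 := by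
    simp only [softWeight_sq, not_lt]
    rw [← Finset.sum_div, div_le_iff₀ (softVol_pos t x)]
    refine (sum_far_exp_le ht x R).trans ?_
    rw [← exp_logVol, ← exp_logVol, ← Real.exp_add]
    have h3 : Real.exp (-(R / (2 * t)) + logVol (2 * t) x) ≤ Real.exp (-1 + logVol t x) := by
      rw [Real.exp_le_exp]
      linarith
    rw [Real.exp_add (-1)] at h3
    refine h3.trans (mul_le_mul_of_nonneg_right ?_ (Real.exp_pos _).le)
    rw [Real.exp_neg, inv_le_comm₀ (Real.exp_pos _) (by norm_num)]
    have := Real.add_one_le_exp (1 : ℝ)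
    linarith
  linarith

/-- One of two points at distance comparable to the scale sees a definite volume growth. -/
theorem one_third_le_volGrowth_or {t : ℝ} (ht : 0 < t) {x y : ι} (h16 : 16 * t ≤ dist x y)
    (h32 : dist x y ≤ 32 * t) : 1 / 3 ≤ volGrowth t x ∨ 1 / 3 ≤ volGrowth t y := by
  by_contra! hcon
  obtain ⟨hx, hy⟩ := hcon
  have hexp3 : Real.exp (1 / 3) ≤ 3 / 2 := by
    have := Real.add_one_le_exp (-(1 / 3) : ℝ)
    have h2 : Real.exp (1 / 3) = (Real.exp (-(1 / 3)))⁻¹ := by rw [← Real.exp_neg]; norm_num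
    rw [h2, inv_le_comm₀ (Real.exp_pos _) (by norm_num)]
    linarith
  have hgrow : ∀ z : ι, volGrowth t z < 1 / 3 → softVol (128 * t) z ≤ 3 / 2 * softVol t z := by
    intro z hz
    rw [← exp_logVol, ← exp_logVol,
      show logVol (128 * t) z = volGrowth t z + logVol t z by rw [volGrowth]; ring, Real.exp_add]
    gcongr
    exact (Real.exp_le_exp.2 hz.le).trans hexp3
  have hexp4 : Real.exp (-4) ≤ 1 / 50 := by
    rw [Real.exp_neg, inv_le_comm₀ (Real.exp_pos _) (by norm_num)]
    have h1 := Real.exp_one_gt_d9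
    have h2 : Real.exp 4 = Real.exp 1 ^ 4 := by rw [← Real.exp_nat_mul]; norm_num
    rw [h2]
    calc (1 / 50 : ℝ)⁻¹ ≤ 2.7182818283 ^ 4 := by norm_num
      _ ≤ _ := by gcongr
  have hnear : ∀ z : ι, volGrowth t z < 1 / 3 →
      9 / 10 * softVol t z ≤ ∑ c with dist z c < dist x y / 2, Real.exp (-(dist z c / t)) := by
    intro z hz
    have h1 := sum_far_exp_le ht z (dist x y / 2)
    have h2 : Real.exp (-(dist x y / 2 / (2 * t))) ≤ 1 / 50 := by
      refine (Real.exp_le_exp.2 ?_).trans hexp4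
      rw [neg_le_neg_iff, le_div_iff₀ (by positivity)]
      linarith
    have h3 : softVol (2 * t) z ≤ 3 / 2 * softVol t z :=
      (softVol_mono (by positivity) (by linarith) z).trans (hgrow z hz)
    have h4 := Finset.sum_filter_add_sum_filter_not Finset.univ (fun c => dist z c < dist x y / 2)
      (fun c => Real.exp (-(dist z c / t)))
    simp only [not_lt] at h4
    change _ = softVol t z at h4
    have h5 : Real.exp (-(dist x y / 2 / (2 * t))) * softVol (2 * t) z ≤
        1 / 50 * (3 / 2 * softVol t z) :=
      mul_le_mul h2 h3 (softVol_pos _ _).le (by norm_num)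
    have h6 := softVol_pos t z
    linarith
  have key : ∀ a b : ι, dist a b = dist x y → volGrowth t a < 1 / 3 → volGrowth t b < 1 / 3 →
      softVol t a ≤ softVol t b → False := by
    intro a b hab ha hb hle
    have h1 : 3 / 4 * ∑ c with dist b c < dist x y / 2, Real.exp (-(dist b c / t)) ≤
        ∑ c with dist b c < dist x y / 2, Real.exp (-(dist a c / (128 * t))) := by
      rw [Finset.mul_sum]
      refine Finset.sum_le_sum fun c _ => ?_
      have h2 : (3 / 4 : ℝ) ≤ Real.exp (-(1 / 4)) := by
        have := Real.add_one_le_exp (-(1 / 4) : ℝ); linarith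
      refine (mul_le_mul_of_nonneg_right h2 (Real.exp_pos _).le).trans ?_
      rw [← Real.exp_add, Real.exp_le_exp]
      have h3 := dist_triangle a b c
      have h4 : dist a c / (128 * t) ≤ (32 * t + dist b c) / (128 * t) := by
        gcongr; linarith
      have h5 : (32 * t + dist b c) / (128 * t) = 1 / 4 + dist b c / (128 * t) := by
        field_simp; ring
      have h6 : dist b c / (128 * t) ≤ dist b c / t := by gcongr; linarith
      linarith
    have h2 : ∑ c with dist a c < dist x y / 2, Real.exp (-(dist a c / t)) ≤
        ∑ c with dist a c < dist x y / 2, Real.exp (-(dist a c / (128 * t))) := by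
      refine Finset.sum_le_sum fun c _ => ?_
      gcongr
      linarith
    have hdisj : Disjoint (Finset.univ.filter fun c => dist a c < dist x y / 2)
        (Finset.univ.filter fun c => dist b c < dist x y / 2) := by
      rw [Finset.disjoint_filter]
      intro c _ hac hbc
      have := dist_triangle_right a b c
      linarith
    have h3 : ∑ c with dist a c < dist x y / 2, Real.exp (-(dist a c / (128 * t))) +
        ∑ c with dist b c < dist x y / 2, Real.exp (-(dist a c / (128 * t))) ≤
          softVol (128 * t) a := by
      classical
      rw [← Finset.sum_union hdisj]
      exact Finset.sum_le_sum_of_subset_of_nonneg (Finset.subset_univ _)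
        fun c _ _ => (Real.exp_pos _).le
    have h4 := hnear a ha
    have h5 := hnear b hb
    have h6 := hgrow a ha
    have h7 := softVol_pos t a
    linarith
  rcases le_total (softVol t x) (softVol t y) with h | h
  · exact key x y rfl hx hy h
  · exact key y x (dist_comm y x) hy hx h

end SoftVolume

/-- Every family of at most `exp L` points of `ℓ_q` has, at every scale `τ`, a `1`-Lipschitz map
into the ball of radius `τ` of Hilbert space which separates points at distance at least `τ` by
at least `τ / K`. -/
def SingleScale (q L K : ℝ) : Prop :=
  ∀ (ι : Type) [Fintype ι], (Fintype.card ι : ℝ) ≤ Real.exp L → ∀ (v : ι → RealLp q) (τ : ℝ),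
    0 < τ → ∃ f : ι → HilbertSeq, (∀ i, ‖f i‖ ≤ τ) ∧ (∀ i j, ‖f i - f j‖ ≤ ‖v i - v j‖) ∧
      ∀ i j, τ ≤ ‖v i - v j‖ → τ / K ≤ ‖f i - f j‖

theorem SingleScale.mono {q L K K' : ℝ} (h : SingleScale q L K) (hK : 0 < K) (hKK' : K ≤ K') :
    SingleScale q L K' := by
  intro ι _ hι v τ hτ
  obtain ⟨f, h1, h2, h3⟩ := h ι hι v τ hτ
  exact ⟨f, h1, h2, fun i j hij => le_trans (by gcongr) (h3 i j hij)⟩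

theorem singleScale_two (L : ℝ) : SingleScale 2 L 2 := by
  have key : ∀ r : ℝ≥0∞, r = 2 → ∀ (ι : Type) [Fintype ι] (v : ι → lp (fun _ : ℕ => ℝ) r) (τ : ℝ),
      0 < τ → ∃ f : ι → HilbertSeq, (∀ i, ‖f i‖ ≤ τ) ∧ (∀ i j, ‖f i - f j‖ ≤ ‖v i - v j‖) ∧
        ∀ i j, τ ≤ ‖v i - v j‖ → τ / 2 ≤ ‖f i - f j‖ := by
    rintro r rfl ι _ v τ hτ
    exact exists_truncation v hτ
  intro ι _ _ v τ hτ
  exact key _ (by norm_num) ι v τ hτ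

/-- Gluing of single scale maps on balls of radius `Δ / 2` by a smooth partition of unity,
modulated by a cutoff function `s`. -/
theorem exists_glued_map {p q : ℝ} [Fact (1 ≤ ENNReal.ofReal p)] (hq : 1 ≤ q) (hpq : q ≤ p) :
    ∃ c : ℝ, 0 < c ∧ c ≤ 1 ∧ ∀ (L K : ℝ), 0 < K → SingleScale q L K →
      ∀ (ι : Type) [Fintype ι] [PseudoMetricSpace ι], (Fintype.card ι : ℝ) ≤ Real.exp L →
      ∀ v : ι → RealLp p, (∀ i j, dist i j = ‖v i - v j‖) →
      ∀ (t Δ : ℝ), 0 < t → t ≤ Δ / 2 → ∀ s : ι → ℝ,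
      ∃ u : ι → HilbertSeq, (∀ i, ‖u i‖ ^ 2 ≤ 2 * (c * t * (Δ / t) ^ (1 - p / q)) ^ 2 * s i ^ 2) ∧
        (∀ i j, ‖u i - u j‖ ^ 2 ≤
          14 * s i ^ 2 * dist i j ^ 2 + 6 * (s i - s j) ^ 2 * t ^ 2) ∧
        ∀ i j, t ≤ dist i j → logVol (2 * t) i - logVol t i + 1 ≤ Δ / (4 * t) →
          s i ^ 2 * (c * t * (Δ / t) ^ (1 - p / q) / K) ^ 2 ≤ 4 * ‖u i - u j‖ ^ 2 := by
  obtain ⟨c, hc0, hc1, hN⟩ := exists_local_map hq hpq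
  refine ⟨c, hc0, hc1, fun L K hK hS ι _ _ hι v hd t Δ ht htΔ s => ?_⟩
  have hΔ : 0 < Δ := by linarith
  obtain ⟨N, hN1, hN2⟩ := hN Δ hΔ
  have hσ : 1 - p / q ≤ 0 := by
    rw [sub_nonpos, one_le_div (by linarith)]; exact hpq
  set T : ℝ := c * t * (Δ / t) ^ (1 - p / q) with hT
  have hT0 : 0 < T := by positivity
  have hTt : T ≤ t := by
    have h1 : (Δ / t) ^ (1 - p / q) ≤ 1 :=
      Real.rpow_le_one_of_one_le_of_nonpos (by rw [one_le_div ht]; linarith) hσ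
    calc T ≤ 1 * t * 1 := by rw [hT]; gcongr
      _ = t := by ring
  choose F hF1 hF2 hF3 using fun k : ι => hS ι hι (fun i => N (v i - v k)) T hT0
  obtain ⟨u, hu1, hu2, hu3⟩ := exists_weighted_concat F (fun k i => s i * softWeight t k i) hF1
  have hFd : ∀ k i j, ‖F k i - F k j‖ ≤ dist i j := fun k i j => by
    refine (hF2 k i j).trans ((hN1 _ _).trans_eq ?_)
    rw [hd, sub_sub_sub_cancel_right]
  refine ⟨u, fun i => ?_, fun i j => ?_, fun i j hij hvol => ?_⟩
  · refine (hu1 i).trans_eq ?_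
    simp only [mul_pow]
    rw [← Finset.mul_sum, sum_softWeight_sq]
    ring
  · refine (hu2 i j).trans ?_
    have h1 : ∀ k, 2 * ((s i * softWeight t k i) ^ 2 * ‖F k i - F k j‖ ^ 2) +
        3 * ((s i * softWeight t k i - s j * softWeight t k j) ^ 2 * T ^ 2) ≤
        2 * s i ^ 2 * dist i j ^ 2 * softWeight t k i ^ 2 +
        (6 * s i ^ 2 * t ^ 2 * (softWeight t k i - softWeight t k j) ^ 2 +
          6 * (s i - s j) ^ 2 * t ^ 2 * softWeight t k j ^ 2) := by
      intro k
      have h2 : ‖F k i - F k j‖ ^ 2 ≤ dist i j ^ 2 := by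
        have := hFd k i j
        gcongr
      have h3 : T ^ 2 ≤ t ^ 2 := by gcongr
      have h4 : (s i * softWeight t k i - s j * softWeight t k j) ^ 2 ≤
          2 * (s i ^ 2 * (softWeight t k i - softWeight t k j) ^ 2 +
            (s i - s j) ^ 2 * softWeight t k j ^ 2) := by
        nlinarith [sq_nonneg (s i * (softWeight t k i - softWeight t k j) -
          (s i - s j) * softWeight t k j)]
      calc _ ≤ 2 * ((s i * softWeight t k i) ^ 2 * dist i j ^ 2) +
          3 * (2 * (s i ^ 2 * (softWeight t k i - softWeight t k j) ^ 2 +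
            (s i - s j) ^ 2 * softWeight t k j ^ 2) * t ^ 2) := by gcongr
        _ = _ := by ring
    refine (Finset.sum_le_sum fun k _ => h1 k).trans ?_
    rw [Finset.sum_add_distrib, Finset.sum_add_distrib, ← Finset.mul_sum, ← Finset.mul_sum,
      ← Finset.mul_sum, sum_softWeight_sq, sum_softWeight_sq]
    have h5 := sum_softWeight_sub_sq_le ht i j
    have h6 : 6 * s i ^ 2 * t ^ 2 * ∑ k, (softWeight t k i - softWeight t k j) ^ 2 ≤
        6 * s i ^ 2 * t ^ 2 * (2 * (dist i j / t) ^ 2) := by gcongr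
    have h7 : 6 * s i ^ 2 * t ^ 2 * (2 * (dist i j / t) ^ 2) = 12 * s i ^ 2 * dist i j ^ 2 := by
      field_simp; ring
    linarith
  · have h1 : 1 / 2 ≤ ∑ k with dist i k < Δ / 2, softWeight t k i ^ 2 :=
      half_le_sum_near_softWeight ht i (hvol.trans_eq (by field_simp; ring))
    have h2 : s i ^ 2 * (T / K) ^ 2 * ∑ k with dist i k < Δ / 2, softWeight t k i ^ 2 ≤
        2 * ‖u i - u j‖ ^ 2 := by
      refine le_trans ?_ (hu3 i j)
      rw [Finset.mul_sum]
      refine le_trans (Finset.sum_le_sum fun k hk => ?_)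
        (Finset.sum_le_sum_of_subset_of_nonneg (Finset.filter_subset _ _)
          fun k _ _ => by positivity)
      have h3 : T / K ≤ ‖F k i - F k j‖ := by
        refine hF3 k i j ?_
        have hk' := (Finset.mem_filter.1 hk).2
        refine hN2 _ _ t (by rw [← hd]; exact hk'.le) ht htΔ ?_
        rw [sub_sub_sub_cancel_right, ← hd]
        exact hij
      calc s i ^ 2 * (T / K) ^ 2 * softWeight t k i ^ 2
          = (s i * softWeight t k i) ^ 2 * (T / K) ^ 2 := by ring
        _ ≤ _ := by gcongr
    have h4 : s i ^ 2 * (T / K) ^ 2 * (1 / 2) ≤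
        s i ^ 2 * (T / K) ^ 2 * ∑ k with dist i k < Δ / 2, softWeight t k i ^ 2 := by gcongr
    linarith

/-- Passing from exponent `q` to exponent `p` costs a factor `L ^ (p / q - 1)`. -/
theorem SingleScale.step {p q : ℝ} (hq : 1 ≤ q) (hpq : q ≤ p) :
    ∃ C : ℝ, 1 ≤ C ∧ ∀ L K : ℝ, 1 ≤ L → 0 < K → SingleScale q L K →
      SingleScale p L (C * K * L ^ (p / q - 1)) := by
  have : Fact (1 ≤ ENNReal.ofReal p) := fact_one_le_ofReal (hq.trans hpq)
  obtain ⟨c, hc0, hc1, hG⟩ := exists_glued_map hq hpq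
  have hσ : 0 ≤ p / q - 1 := by
    rw [sub_nonneg, one_le_div (by linarith)]; exact hpq
  refine ⟨8 * 8 ^ (p / q - 1) / c, ?_, fun L K hL hK hS ι _ hι v τ hτ => ?_⟩
  · rw [one_le_div hc0]
    have := Real.one_le_rpow (show (1 : ℝ) ≤ 8 by norm_num) hσ
    linarith
  let _ : PseudoMetricSpace ι := PseudoMetricSpace.induced v inferInstance
  have hd : ∀ i j, dist i j = ‖v i - v j‖ := fun i j => dist_eq_norm (v i) (v j)
  obtain ⟨u, hu1, hu2, hu3⟩ := hG L K hK hS ι hι v hd τ (8 * τ * L) hτ (by nlinarith) (fun _ => 1)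
  have e1 : 8 * τ * L / τ = 8 * L := by field_simp
  rw [e1] at hu1 hu3
  set T : ℝ := c * τ * (8 * L) ^ (1 - p / q) with hT
  have hT0 : 0 < T := by positivity
  have hTt : T ≤ τ := by
    have h1 : (8 * L) ^ (1 - p / q) ≤ 1 :=
      Real.rpow_le_one_of_one_le_of_nonpos (by linarith) (by linarith)
    calc T ≤ 1 * τ * 1 := by rw [hT]; gcongr
      _ = τ := by ring
  have hn : ∀ w : HilbertSeq, ‖(1 / 4 : ℝ) • w‖ = ‖w‖ / 4 := fun w => by
    rw [norm_smul]; norm_num; ring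
  refine ⟨fun i => (1 / 4 : ℝ) • u i, fun i => ?_, fun i j => ?_, fun i j hij => ?_⟩
  · rw [hn]
    have h1 := hu1 i
    have h2 : ‖u i‖ ≤ 4 * τ := by
      refine abs_le_of_sq_le_sq' ?_ (by positivity) |>.2
      have : T ^ 2 ≤ τ ^ 2 := by gcongr
      nlinarith
    linarith
  · rw [← smul_sub, hn]
    have h1 := hu2 i j
    rw [hd] at h1
    have h2 : ‖u i - u j‖ ≤ 4 * ‖v i - v j‖ := by
      refine abs_le_of_sq_le_sq' ?_ (by positivity) |>.2
      nlinarith [sq_nonneg ‖v i - v j‖]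
    linarith
  · rw [← smul_sub, hn]
    have h1 := hu3 i j (by rw [hd]; exact hij) (by
      have h2 := logVol_le (show 0 < 2 * τ by positivity) hι i
      have h3 := logVol_nonneg τ i
      have h4 : 8 * τ * L / (4 * τ) = 2 * L := by field_simp; ring
      rw [h4]; linarith)
    have h2 : T / K ≤ 2 * ‖u i - u j‖ := by
      refine abs_le_of_sq_le_sq' ?_ (by positivity) |>.2
      nlinarith
    have h3 : τ / (8 * 8 ^ (p / q - 1) / c * K * L ^ (p / q - 1)) = T / K / 8 := by
      rw [hT, show 1 - p / q = -(p / q - 1) by ring, Real.rpow_neg (by positivity),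
        Real.mul_rpow (by norm_num) (by linarith)]
      field_simp
    rw [h3]
    linarith

theorem exists_singleScale {q ε : ℝ} (hq : 2 ≤ q) (hε : 0 < ε) :
    ∃ C : ℝ, 1 ≤ C ∧ ∀ L : ℝ, 1 ≤ L → SingleScale q L (C * L ^ (Real.log (q / 2) + ε)) := by
  have hlog : 0 ≤ Real.log (q / 2) := Real.log_nonneg (by linarith)
  set l := Real.log (q / 2) with hl
  obtain ⟨M, hM⟩ := exists_nat_gt (max l (l ^ 2 / ε))
  have hM0 : (0 : ℝ) < M := hlog.trans_lt ((le_max_left _ _).trans_lt hM)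
  have hMl : l < M := (le_max_left _ _).trans_lt hM
  have hMε : l ^ 2 / ε < M := (le_max_right _ _).trans_lt hM
  set r := Real.exp (l / M) with hr
  have hr1 : 1 ≤ r := Real.one_le_exp (by positivity)
  have chain : ∀ m : ℕ, ∃ C : ℝ, 1 ≤ C ∧ ∀ L : ℝ, 1 ≤ L →
      SingleScale (2 * r ^ m) L (C * L ^ (m * (r - 1))) := by
    intro m
    induction m with
    | zero =>
      refine ⟨2, by norm_num, fun L hL => ?_⟩
      simpa using singleScale_two L
    | succ m ih =>
      obtain ⟨C, hC, hS⟩ := ih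
      have h1 : (1 : ℝ) ≤ r ^ m := one_le_pow₀ hr1
      obtain ⟨C', hC', hS'⟩ := SingleScale.step (q := 2 * r ^ m) (p := 2 * r ^ (m + 1))
        (by linarith) (by rw [pow_succ]; nlinarith)
      refine ⟨C' * C, by nlinarith, fun L hL => ?_⟩
      have h2 := hS' L _ hL (by positivity) (hS L hL)
      have h3 : 2 * r ^ (m + 1) / (2 * r ^ m) = r := by
        rw [pow_succ]; field_simp
      rw [h3] at h2
      convert h2 using 1
      push_cast
      rw [add_mul, one_mul, Real.rpow_add (by linarith)]
      ring
  obtain ⟨C, hC, hS⟩ := chain M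
  refine ⟨C, hC, fun L hL => ?_⟩
  have hrM : 2 * r ^ M = q := by
    rw [hr, ← Real.exp_nat_mul, mul_div_cancel₀ _ hM0.ne', hl, Real.exp_log (by linarith)]
    ring
  rw [hrM] at hS
  refine (hS L hL).mono (by positivity) ?_
  gcongr
  have h1 : |l / M| ≤ 1 := by
    rw [abs_of_nonneg (by positivity), div_le_one hM0]; exact hMl.le
  have h2 := (le_abs_self _).trans (Real.abs_exp_sub_one_sub_id_le h1)
  calc M * (r - 1) ≤ M * (l / M + (l / M) ^ 2) := by gcongr; linarith
    _ = l + l ^ 2 / M := by field_simp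
    _ ≤ l + ε := by
      gcongr
      rw [div_le_iff₀ hM0]
      rw [div_lt_iff₀ hε] at hMε
      linarith

/-- The quadratic cutoff function used to localise at points where the volume growth `g` is at
least `θ`. -/
def growthCutoff (θ g : ℝ) : ℝ := √θ * max 0 (min 1 (2 * g / θ - 1))

theorem growthCutoff_sq_of_le {θ g : ℝ} (hθ : 0 < θ) (h : θ ≤ g) : growthCutoff θ g ^ 2 = θ := by
  have h1 : 1 ≤ 2 * g / θ - 1 := by
    rw [le_sub_iff_add_le, le_div_iff₀ hθ]; linarith
  rw [growthCutoff, min_eq_left h1, max_eq_right zero_le_one, mul_one, Real.sq_sqrt hθ.le]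

theorem growthCutoff_eq_zero {θ g : ℝ} (hθ : 0 < θ) (h : 2 * g ≤ θ) : growthCutoff θ g = 0 := by
  have h1 : 2 * g / θ - 1 ≤ 0 := by
    rw [sub_nonpos, div_le_one hθ]; exact h
  rw [growthCutoff, max_eq_left ((min_le_right _ _).trans h1), mul_zero]

theorem growthCutoff_sq_le {θ g : ℝ} (hθ : 0 < θ) (hg : 0 ≤ g) :
    growthCutoff θ g ^ 2 ≤ 2 * g := by
  rcases le_total (2 * g) θ with h | h
  · rw [growthCutoff_eq_zero hθ h]; linarith
  · rw [growthCutoff, mul_pow, Real.sq_sqrt hθ.le]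
    have h1 : max 0 (min 1 (2 * g / θ - 1)) ^ 2 ≤ 1 :=
      pow_le_one₀ (le_max_left _ _) (max_le zero_le_one (min_le_left _ _))
    nlinarith

theorem growthCutoff_sub_sq_le {θ g g' : ℝ} (hθ : 1 / 3 ≤ θ) (hg : 0 ≤ g) (hg' : 0 ≤ g') :
    (growthCutoff θ g - growthCutoff θ g') ^ 2 ≤ 72 * (g - g') ^ 2 * (g + g') := by
  have hθ0 : 0 < θ := by linarith
  by_cases h : 2 * g ≤ θ ∧ 2 * g' ≤ θ
  · rw [growthCutoff_eq_zero hθ0 h.1, growthCutoff_eq_zero hθ0 h.2]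
    have : 0 ≤ 72 * (g - g') ^ 2 * (g + g') := by positivity
    simpa using this
  · have h1 : θ ≤ 2 * (g + g') := by
      by_contra! h2
      exact h ⟨by linarith, by linarith⟩
    have h2 : |max 0 (min 1 (2 * g / θ - 1)) - max 0 (min 1 (2 * g' / θ - 1))| ≤
        |2 / θ * (g - g')| := by
      have e : 2 / θ * (g - g') = (2 * g / θ - 1) - (2 * g' / θ - 1) := by field_simp; ring
      rw [e]
      refine (abs_max_sub_max_le_max _ _ _ _).trans (max_le (by simp) ?_)
      exact (abs_min_sub_min_le_max _ _ _ _).trans (max_le (by simp) le_rfl)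
    have h3 : (growthCutoff θ g - growthCutoff θ g') ^ 2 ≤ θ * (2 / θ * (g - g')) ^ 2 := by
      rw [growthCutoff, growthCutoff, ← mul_sub, mul_pow, Real.sq_sqrt hθ0.le]
      exact mul_le_mul_of_nonneg_left (sq_le_sq.2 h2) hθ0.le
    refine h3.trans ?_
    have h4 : θ * (2 / θ * (g - g')) ^ 2 = 4 * (g - g') ^ 2 * (1 / θ) := by field_simp; ring
    have h5 : 1 / θ ≤ 18 * (g + g') := by
      rw [div_le_iff₀ hθ0]
      nlinarith
    rw [h4]
    calc 4 * (g - g') ^ 2 * (1 / θ) ≤ 4 * (g - g') ^ 2 * (18 * (g + g')) := by gcongr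
      _ = _ := by ring

theorem exponent_le {p γ δ : ℝ} (hp : 3 < p) (hγ : 0 ≤ γ) (hδ : 0 ≤ δ) :
    (γ + δ) * (p / max 2 (γ * p) - 1) + Real.log (max 2 (γ * p) / 2) - γ / 2 ≤
      Real.log (p / 3) + δ * p / 2 := by
  set q := max 2 (γ * p) with hq
  have hq2 : 2 ≤ q := le_max_left _ _
  have h1 : δ * (p / q - 1) ≤ δ * p / 2 := by
    have : p / q ≤ p / 2 := by gcongr
    nlinarith
  have h2 : γ * (p / q - 1) + Real.log (q / 2) - γ / 2 ≤ Real.log (p / 3) := by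
    rcases le_total (γ * p) 2 with h | h
    · have hq' : q = 2 := max_eq_left h
      have h3 := Real.one_sub_inv_le_log_of_pos (show 0 < p / 3 by linarith)
      have h4 : γ * (p / 2 - 1) - γ / 2 ≤ 1 - (p / 3)⁻¹ := by
        have h5 : γ ≤ 2 / p := by rw [le_div_iff₀ (by linarith)]; exact h
        have h6 : 1 - (p / 3)⁻¹ = 2 / p * ((p - 3) / 2) := by field_simp
        rw [h6]
        have h7 : γ * (p / 2 - 1) - γ / 2 = γ * ((p - 3) / 2) := by ring
        rw [h7]
        exact mul_le_mul_of_nonneg_right h5 (by linarith)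
      rw [hq']
      simp only [div_self (two_ne_zero' ℝ), Real.log_one]
      linarith
    · have hq' : q = γ * p := max_eq_right h
      have hγ0 : 0 < γ := by
        rcases hγ.eq_or_lt with h0 | h0
        · rw [← h0] at h; linarith
        · exact h0
      have h3 := Real.log_le_sub_one_of_pos (show 0 < 3 * γ / 2 by positivity)
      have h4 : Real.log (γ * p / 2) = Real.log (p / 3) + Real.log (3 * γ / 2) := by
        rw [← Real.log_mul (by positivity) (by positivity)]
        congr 1; field_simp
      have h5 : γ * (p / (γ * p) - 1) = 1 - γ := by field_simp
      rw [hq', h4, h5]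
      linarith
  linarith

/-- Embedding which handles, at a single scale `t`, all points with volume growth of order
between `L ^ γ` and `L ^ (γ + δ)`. -/
theorem exists_growth_class_map {p γ δ ε : ℝ} [Fact (1 ≤ ENNReal.ofReal p)] (hp : 3 < p)
    (hγ : 0 ≤ γ) (hγ1 : γ ≤ 1) (hδ : 0 ≤ δ) (hε : 0 < ε) :
    ∃ D : ℝ, 0 < D ∧ ∀ L : ℝ, 1 ≤ L → ∀ (ι : Type) [Fintype ι] [PseudoMetricSpace ι],
      (Fintype.card ι : ℝ) ≤ Real.exp L → ∀ v : ι → RealLp p, (∀ i j, dist i j = ‖v i - v j‖) →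
      ∀ t : ℝ, 0 < t → ∃ u : ι → HilbertSeq,
        (∀ i j, ‖u i - u j‖ ^ 2 ≤ 1756 * dist i j ^ 2 * (volGrowth t i + volGrowth t j)) ∧
        ∀ i j, L ^ γ / 3 ≤ volGrowth t i → volGrowth t i ≤ L ^ (γ + δ) → t ≤ dist i j →
          t ^ 2 ≤ D * L ^ (2 * (Real.log (p / 3) + δ * p / 2 + ε)) * ‖u i - u j‖ ^ 2 := by
  have hexp := exponent_le hp hγ hδ
  set q := max 2 (γ * p) with hq
  have hq2 : 2 ≤ q := le_max_left _ _
  have hqp : q ≤ p := max_le (by linarith) (by nlinarith)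
  obtain ⟨C, hC, hS⟩ := exists_singleScale hq2 hε
  obtain ⟨c, hc0, hc1, hG⟩ := exists_glued_map (show 1 ≤ q by linarith) hqp
  have hσ : 0 ≤ p / q - 1 := by
    rw [sub_nonneg, one_le_div (by linarith)]; exact hqp
  refine ⟨12 * C ^ 2 * (8 ^ (p / q - 1)) ^ 2 / c ^ 2, by positivity,
    fun L hL ι _ _ hι v hd t ht => ?_⟩
  have hL0 : 0 < L := by linarith
  set θ := L ^ γ / 3 with hθ
  set θ' := L ^ (γ + δ) with hθ'
  have hθ3 : 1 / 3 ≤ θ := by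
    have := Real.one_le_rpow hL hγ
    rw [hθ]; linarith
  have hθ1 : 1 ≤ θ' := Real.one_le_rpow hL (by linarith)
  have hθ0 : 0 < θ := by linarith
  set K := C * L ^ (Real.log (q / 2) + ε) with hK
  have hK0 : 0 < K := by positivity
  obtain ⟨u, -, hu2, hu3⟩ := hG L K hK0 (hS L hL) ι hι v hd t (4 * t * (θ' + 1)) ht (by nlinarith)
    (fun i => growthCutoff θ (volGrowth t i))
  refine ⟨u, fun i j => ?_, fun i j hi hi' hij => ?_⟩
  · have hgi := volGrowth_nonneg ht i
    have hgj := volGrowth_nonneg ht j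
    have h1 := growthCutoff_sq_le hθ0 hgi
    have h2 := growthCutoff_sub_sq_le hθ3 hgi hgj
    have h3 : (volGrowth t i - volGrowth t j) ^ 2 ≤ (2 * dist i j / t) ^ 2 :=
      sq_le_sq.2 ((abs_volGrowth_sub_le ht i j).trans (le_abs_self _))
    calc ‖u i - u j‖ ^ 2 ≤ _ := hu2 i j
      _ ≤ 14 * (2 * volGrowth t i) * dist i j ^ 2 + 6 * (72 * (2 * dist i j / t) ^ 2 *
          (volGrowth t i + volGrowth t j)) * t ^ 2 := by
        gcongr
        exact h2.trans (by gcongr)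
      _ = dist i j ^ 2 * (1756 * volGrowth t i + 1728 * volGrowth t j) := by field_simp; ring
      _ ≤ dist i j ^ 2 * (1756 * volGrowth t i + 1756 * volGrowth t j) := by gcongr; norm_num
      _ = _ := by ring
  · have e1 : 4 * t * (θ' + 1) / (4 * t) = θ' + 1 := by field_simp
    have e2 : 4 * t * (θ' + 1) / t = 4 * (θ' + 1) := by field_simp
    have h1 := hu3 i j hij (by
      rw [e1]
      have := logVol_mono (show 0 < 2 * t by positivity) (show 2 * t ≤ 128 * t by linarith) i
      rw [volGrowth] at hi'
      linarith)
    rw [growthCutoff_sq_of_le hθ0 hi, e2, show 1 - p / q = -(p / q - 1) by ring,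
      Real.rpow_neg (by positivity)] at h1
    have h2 : (4 * (θ' + 1)) ^ (p / q - 1) ≤ 8 ^ (p / q - 1) * L ^ ((γ + δ) * (p / q - 1)) := by
      rw [Real.rpow_mul hL0.le, ← hθ', ← Real.mul_rpow (by norm_num) (by positivity)]
      exact Real.rpow_le_rpow (by positivity) (by linarith) hσ
    set A := (4 * (θ' + 1)) ^ (p / q - 1) with hA
    have hA0 : 0 < A := by positivity
    have h3 : t ^ 2 ≤ 4 * ‖u i - u j‖ ^ 2 * K ^ 2 * A ^ 2 / (c ^ 2 * θ) := by
      rw [le_div_iff₀ (by positivity)]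
      have e3 : θ * (c * t * A⁻¹ / K) ^ 2 = t ^ 2 * (c ^ 2 * θ) / (K ^ 2 * A ^ 2) := by
        field_simp
      rw [e3, div_le_iff₀ (by positivity)] at h1
      linarith
    refine h3.trans ?_
    have h4 : L ^ (2 * (Real.log (q / 2) + ε) + 2 * ((γ + δ) * (p / q - 1)) - γ) ≤
        L ^ (2 * (Real.log (p / 3) + δ * p / 2 + ε)) :=
      Real.rpow_le_rpow_of_exponent_le hL (by linarith)
    rw [Real.rpow_sub hL0, Real.rpow_add hL0, mul_comm (2 : ℝ) (Real.log (q / 2) + ε),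
      mul_comm (2 : ℝ) ((γ + δ) * _), Real.rpow_mul hL0.le, Real.rpow_mul hL0.le,
      Real.rpow_two, Real.rpow_two] at h4
    set B := L ^ (Real.log (q / 2) + ε)
    set E := L ^ ((γ + δ) * (p / q - 1))
    calc 4 * ‖u i - u j‖ ^ 2 * K ^ 2 * A ^ 2 / (c ^ 2 * θ)
        ≤ 4 * ‖u i - u j‖ ^ 2 * K ^ 2 * (8 ^ (p / q - 1) * E) ^ 2 / (c ^ 2 * θ) := by gcongr
      _ = 12 * C ^ 2 * (8 ^ (p / q - 1)) ^ 2 / c ^ 2 * (B ^ 2 * E ^ 2 / L ^ γ) *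
          ‖u i - u j‖ ^ 2 := by
        rw [hK, hθ]; field_simp; ring
      _ ≤ _ := by gcongr

theorem sum_range_shift_sub_le {h : ℕ → ℝ} {L : ℝ} (h0 : ∀ k, 0 ≤ h k) (hL : ∀ k, h k ≤ L)
    (K m : ℕ) : ∑ k ∈ Finset.range K, (h (k + m) - h k) ≤ m * L := by
  induction m with
  | zero => simp
  | succ m ih =>
    have h1 : ∑ k ∈ Finset.range K, (h (k + (m + 1)) - h k) =
        ∑ k ∈ Finset.range K, (h (k + 1 + m) - h (k + m)) +
          ∑ k ∈ Finset.range K, (h (k + m) - h k) := by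
      rw [← Finset.sum_add_distrib]
      refine Finset.sum_congr rfl fun k _ => ?_
      rw [show k + (m + 1) = k + 1 + m by ring]
      ring
    have h2 := Finset.sum_range_sub (fun k => h (k + m)) K
    rw [h1, h2]
    have h3 := hL (K + m)
    have h4 := h0 (0 + m)
    push_cast
    linarith

theorem exists_growth_class {N : ℕ} (hN : 0 < N) {L g : ℝ} (hL : 1 ≤ L) (hg : 1 / 3 ≤ g)
    (hgL : g ≤ L) :
    ∃ j < N, L ^ ((j : ℝ) / N) / 3 ≤ g ∧ g ≤ L ^ ((j : ℝ) / N + 1 / N) := by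
  have hN' : (0 : ℝ) < N := by exact_mod_cast hN
  have h1 : ∃ j : ℕ, g ≤ L ^ ((j : ℝ) / N + 1 / N) := by
    refine ⟨N, hgL.trans ?_⟩
    conv_lhs => rw [← Real.rpow_one L]
    refine Real.rpow_le_rpow_of_exponent_le hL ?_
    rw [div_self hN'.ne']
    have : 0 < 1 / (N : ℝ) := by positivity
    linarith
  classical
  refine ⟨Nat.find h1, ?_, ?_, Nat.find_spec h1⟩
  · rw [Nat.find_lt_iff]
    refine ⟨N - 1, by omega, ?_⟩
    rw [Nat.cast_sub (by omega), ← add_div]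
    simpa [div_self hN'.ne'] using hgL
  · rcases Nat.eq_zero_or_pos (Nat.find h1) with h | h
    · rw [h]; simpa using hg
    · have h2 := Nat.find_min h1 (Nat.sub_lt h one_pos)
      rw [not_le, Nat.cast_sub (by omega), ← add_div] at h2
      simp only [Nat.cast_one, sub_add_cancel] at h2
      have : 0 < L ^ ((Nat.find h1 : ℝ) / N) := by positivity
      linarith

theorem exists_scales (ι : Type*) [Fintype ι] [PseudoMetricSpace ι] :
    ∃ t : ℝ, 0 < t ∧ ∃ K : ℕ, ∀ i j : ι, 0 < dist i j →
      ∃ k < K, 16 * (t * 2 ^ k) ≤ dist i j ∧ dist i j ≤ 32 * (t * 2 ^ k) := by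
  set S : ℝ := ∑ i : ι, ∑ j : ι, 1 / dist i j with hS
  have hS0 : 0 ≤ S := by positivity
  set t : ℝ := 1 / (16 * (1 + S)) with ht
  have ht0 : 0 < t := by positivity
  have key : ∀ i j : ι, ∃ k : ℕ, 0 < dist i j →
      16 * (t * 2 ^ k) ≤ dist i j ∧ dist i j ≤ 32 * (t * 2 ^ k) := by
    intro i j
    by_cases hij : 0 < dist i j
    · have h1 : 1 / dist i j ≤ S :=
        (Finset.single_le_sum (f := fun j => 1 / dist i j) (fun _ _ => by positivity)
          (Finset.mem_univ j)).trans
        (Finset.single_le_sum (f := fun i => ∑ j : ι, 1 / dist i j) (fun _ _ => by positivity)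
          (Finset.mem_univ i))
      have h2 : 1 ≤ dist i j / (16 * t) := by
        rw [div_le_iff₀ hij] at h1
        rw [ht]
        field_simp
        linarith
      obtain ⟨k, hk1, hk2⟩ := exists_nat_pow_near h2 (one_lt_two (α := ℝ))
      rw [le_div_iff₀ (by positivity)] at hk1
      rw [div_lt_iff₀ (by positivity), pow_succ] at hk2
      exact ⟨k, fun _ => ⟨by linarith, by linarith⟩⟩
    · exact ⟨0, fun h => absurd h hij⟩
  choose κ hκ using key
  refine ⟨t, ht0, ∑ i, ∑ j, κ i j + 1, fun i j hij => ⟨κ i j, ?_, hκ i j hij⟩⟩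
  rw [Nat.lt_succ_iff]
  exact (Finset.single_le_sum (f := fun j => κ i j) (fun _ _ => Nat.zero_le _)
      (Finset.mem_univ j)).trans
    (Finset.single_le_sum (f := fun i => ∑ j, κ i j) (fun _ _ => Nat.zero_le _)
      (Finset.mem_univ i))

theorem sum_volGrowth_le {ι : Type*} [Fintype ι] [PseudoMetricSpace ι] {t L : ℝ} (ht : 0 < t)
    (hL : (Fintype.card ι : ℝ) ≤ Real.exp L) (K : ℕ) (x : ι) :
    ∑ k : Fin K, volGrowth (t * 2 ^ (k : ℕ)) x ≤ 7 * L := by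
  rw [Fin.sum_univ_eq_sum_range (fun k => volGrowth (t * 2 ^ k) x)]
  have h1 := sum_range_shift_sub_le (h := fun k => logVol (t * 2 ^ k) x)
    (fun k => logVol_nonneg _ x) (fun k => logVol_le (by positivity) hL x) K 7
  refine le_trans (le_of_eq ?_) (h1.trans_eq (by norm_num))
  refine Finset.sum_congr rfl fun k _ => ?_
  rw [volGrowth, pow_add]
  congr 2
  ring

theorem exists_hilbert_embedding {p ε : ℝ} [Fact (1 ≤ ENNReal.ofReal p)] (hp : 3 < p)
    (hε : 0 < ε) :
    ∃ A D : ℝ, 0 < A ∧ 0 < D ∧ ∀ L : ℝ, 1 ≤ L → ∀ (ι : Type) [Fintype ι] [PseudoMetricSpace ι],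
      (Fintype.card ι : ℝ) ≤ Real.exp L → ∀ v : ι → RealLp p, (∀ i j, dist i j = ‖v i - v j‖) →
      ∃ w : ι → HilbertSeq, (∀ i j, ‖w i - w j‖ ^ 2 ≤ A * L * dist i j ^ 2) ∧
        ∀ i j, dist i j ^ 2 ≤ D * L ^ (2 * (Real.log (p / 3) + ε)) * ‖w i - w j‖ ^ 2 := by
  obtain ⟨N, hN⟩ := exists_nat_gt (p / ε)
  have hN' : (0 : ℝ) < N := lt_trans (by positivity) hN
  have hN0 : 0 < N := by exact_mod_cast hN'
  have hclass : ∀ j : Fin N, _ := fun j : Fin N =>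
    exists_growth_class_map (p := p) (γ := (j : ℝ) / N) (δ := 1 / N) (ε := ε / 2) hp
      (by positivity) (by rw [div_le_one hN']; exact_mod_cast j.2.le) (by positivity) (half_pos hε)
  choose D hD0 hD using hclass
  have hDpos : 0 < ∑ j, D j :=
    Finset.sum_pos (fun j _ => hD0 j) ⟨⟨0, hN0⟩, Finset.mem_univ _⟩
  refine ⟨N * 1756 * 14, 32 ^ 2 * ∑ j, D j, by positivity, by positivity,
    fun L hL ι _ _ hι v hd => ?_⟩
  obtain ⟨t, ht, K, hK⟩ := exists_scales ι
  choose U hU1 hU2 using fun (k : Fin K) (j : Fin N) =>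
    hD j L hL ι hι v hd (t * 2 ^ (k : ℕ)) (by positivity)
  obtain ⟨w, -, hw⟩ := exists_concat (fun a : Fin K × Fin N => U a.1 a.2)
  have hle : ∀ (a : Fin K × Fin N) (i j : ι),
      ‖U a.1 a.2 i - U a.1 a.2 j‖ ^ 2 ≤ ‖w i - w j‖ ^ 2 := fun a i j =>
    (Finset.single_le_sum (f := fun a : Fin K × Fin N => ‖U a.1 a.2 i - U a.1 a.2 j‖ ^ 2)
      (fun _ _ => sq_nonneg _) (Finset.mem_univ a)).trans_eq (hw i j).symm
  refine ⟨w, fun i j => ?_, ?_⟩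
  · rw [hw, Fintype.sum_prod_type]
    have h1 : ∀ k : Fin K, ∑ m : Fin N, ‖U k m i - U k m j‖ ^ 2 ≤ N * 1756 * dist i j ^ 2 *
        (volGrowth (t * 2 ^ (k : ℕ)) i + volGrowth (t * 2 ^ (k : ℕ)) j) := fun k => by
      refine (Finset.sum_le_card_nsmul _ _ _ fun m _ => hU1 k m i j).trans_eq ?_
      rw [Finset.card_univ, Fintype.card_fin, nsmul_eq_mul]
      ring
    refine (Finset.sum_le_sum fun k _ => h1 k).trans ?_
    rw [← Finset.mul_sum, Finset.sum_add_distrib]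
    have h2 := sum_volGrowth_le ht hι K i
    have h3 := sum_volGrowth_le ht hι K j
    calc _ ≤ N * 1756 * dist i j ^ 2 * (7 * L + 7 * L) :=
          mul_le_mul_of_nonneg_left (add_le_add h2 h3) (by positivity)
      _ = _ := by ring
  · have key : ∀ i j, ∀ k : Fin K, 16 * (t * 2 ^ (k : ℕ)) ≤ dist i j →
        dist i j ≤ 32 * (t * 2 ^ (k : ℕ)) → 1 / 3 ≤ volGrowth (t * 2 ^ (k : ℕ)) i →
        dist i j ^ 2 ≤ 32 ^ 2 * (∑ l, D l) * L ^ (2 * (Real.log (p / 3) + ε)) *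
          ‖w i - w j‖ ^ 2 := by
      intro i j k h1 h2 h3
      have ht' : 0 < t * 2 ^ (k : ℕ) := by positivity
      have hgL : volGrowth (t * 2 ^ (k : ℕ)) i ≤ L := by
        have h4 := logVol_le (show 0 < 128 * (t * 2 ^ (k : ℕ)) by positivity) hι i
        have h5 := logVol_nonneg (t * 2 ^ (k : ℕ)) i
        rw [volGrowth]; linarith
      obtain ⟨m, hm, hm1, hm2⟩ := exists_growth_class hN0 hL h3 hgL
      have h4 := hU2 k ⟨m, hm⟩ i j hm1 hm2 (by linarith)
      have h5 := hle ⟨k, m, hm⟩ i j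
      have h6 : D ⟨m, hm⟩ ≤ ∑ l, D l :=
        Finset.single_le_sum (fun l _ => (hD0 l).le) (Finset.mem_univ _)
      have h7 : L ^ (2 * (Real.log (p / 3) + 1 / N * p / 2 + ε / 2)) ≤
          L ^ (2 * (Real.log (p / 3) + ε)) := by
        refine Real.rpow_le_rpow_of_exponent_le hL ?_
        have h8 : 1 / N * p ≤ ε := by
          rw [div_lt_iff₀ hε] at hN
          rw [one_div_mul_eq_div, div_le_iff₀ hN']
          linarith
        linarith
      calc dist i j ^ 2 ≤ (32 * (t * 2 ^ (k : ℕ))) ^ 2 := by gcongr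
        _ = 32 ^ 2 * (t * 2 ^ (k : ℕ)) ^ 2 := by ring
        _ ≤ 32 ^ 2 * ((∑ l, D l) * L ^ (2 * (Real.log (p / 3) + ε)) * ‖w i - w j‖ ^ 2) := by
          refine mul_le_mul_of_nonneg_left (h4.trans ?_) (by norm_num)
          gcongr
        _ = _ := by ring
    intro i j
    rcases dist_nonneg.eq_or_lt (a := (0 : ℝ)) (b := dist i j) with h0 | h0
    · rw [← h0]
      have : 0 ≤ 32 ^ 2 * (∑ l, D l) * L ^ (2 * (Real.log (p / 3) + ε)) * ‖w i - w j‖ ^ 2 := by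
        positivity
      simpa using this
    · obtain ⟨k, hk, h1, h2⟩ := hK i j h0
      rcases one_third_le_volGrowth_or (by positivity) h1 h2 with h3 | h3
      · exact key i j ⟨k, hk⟩ h1 h2 h3
      · rw [dist_comm i j, norm_sub_rev]
        rw [dist_comm] at h1 h2
        exact key j i ⟨k, hk⟩ h1 h2 h3

/-- For every real `p` with `3 < p < 3√e` and every `ε` with `0 < ε ≤ 1`, there exists a
constant `C = C(p, ε) > 0` such that for every integer `n ≥ 2` and every subset `X` of
`ℓ_p` with at most `n` points, `X` embeds into the Hilbert space `ℓ_2` with distortion at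
most `C * (log n) ^ (1/2 + log (p/3) + ε)`. -/
theorem embedding_lp_into_l2 (p : ℝ) (hp₁ : 3 < p) (hp₂ : p < 3 * Real.sqrt (Real.exp 1))
    [Fact (1 ≤ ENNReal.ofReal p)]
    (ε : ℝ) (hε₁ : 0 < ε) (hε₂ : ε ≤ 1) :
    ∃ C : ℝ, 0 < C ∧
      ∀ (n : ℕ), 2 ≤ n →
      ∀ (X : Set (lp (fun _ : ℕ => ℝ) (ENNReal.ofReal p))),
        X.Finite → X.ncard ≤ n →
        EmbedsWithDistortion X (lp (fun _ : ℕ => ℝ) 2)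
          (C * Real.log n ^ ((1 : ℝ) / 2 + Real.log (p / 3) + ε)) := by
  obtain ⟨A, D, hA, hD, hmain⟩ := exists_hilbert_embedding hp₁ hε₁
  set β := Real.log (p / 3) + ε with hβ
  refine ⟨√A * √D * 2 ^ (1 / 2 + β), by positivity, fun n hn X hX hXn => ?_⟩
  have hn' : (2 : ℝ) ≤ n := by exact_mod_cast hn
  have hlog : 1 / 2 ≤ Real.log n := by
    have h1 := Real.log_two_gt_d9
    have h2 := Real.log_le_log two_pos hn'
    linarith
  set L := 2 * Real.log n with hL
  have hL1 : 1 ≤ L := by linarith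
  have hL0 : 0 < L := by linarith
  have := hX.fintype
  have hcard : (Fintype.card X : ℝ) ≤ Real.exp L := by
    rw [← Nat.card_coe_set_eq, Nat.card_eq_fintype_card] at hXn
    have h1 : (n : ℝ) ≤ Real.exp L := by
      conv_lhs => rw [← Real.exp_log (show (0 : ℝ) < n by linarith)]
      rw [Real.exp_le_exp]
      linarith
    exact le_trans (by exact_mod_cast hXn) h1
  obtain ⟨w, hw1, hw2⟩ := hmain L hL1 X hcard (fun x => (x : RealLp p))
    (fun i j => by rw [Subtype.dist_eq, dist_eq_norm])
  have e1 : √A * √D * 2 ^ (1 / 2 + β) * Real.log n ^ ((1 : ℝ) / 2 + Real.log (p / 3) + ε) =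
      √A * √L * (√D * L ^ β) := by
    rw [add_assoc, ← hβ, mul_assoc (√A * √D), ← Real.mul_rpow (by norm_num) (by linarith), ← hL,
      Real.rpow_add hL0, ← Real.sqrt_eq_rpow]
    ring
  have hs : 0 < √A * √L := by positivity
  have hB : 0 < √D * L ^ β := by positivity
  refine ⟨√A * √L, hs, w, fun x y => ⟨?_, ?_⟩⟩
  · rw [e1, dist_eq_norm (w x)]
    have h1 : √A * √L / (√A * √L * (√D * L ^ β)) * dist x y = dist x y / (√D * L ^ β) := by
      field_simp
    rw [h1, div_le_iff₀ hB]
    refine abs_le_of_sq_le_sq' ?_ (by positivity) |>.2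
    refine (hw2 x y).trans_eq ?_
    rw [mul_pow, mul_pow, Real.sq_sqrt hD.le, mul_comm (2 : ℝ) β, Real.rpow_mul hL0.le,
      Real.rpow_two]
    ring
  · rw [dist_eq_norm (w x)]
    refine abs_le_of_sq_le_sq' ?_ (by positivity) |>.2
    refine (hw1 x y).trans_eq ?_
    rw [mul_pow, mul_pow, Real.sq_sqrt hA.le, Real.sq_sqrt hL0.le]
end
end
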